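/- arXiv:math/9810012 — 2 statements merged into one kernel-verified Lean document; each statement's English description precedes it below -/
import Mathlib

section
/- The space rat(2,2) is homotopy equivalent to the quotient space of the torus S¹ × S¹ obtained by collapsing the meridian {x₀} × S¹ (for a fixed point x₀ ∈ S¹) to a single point. -/
open OnePoint Projectivization

noncomputable section

/-- Real projective `m`-space, the projectivization of `ℝ^{m+1}`. -/
abbrev RP (m : ℕ) := Projectivization ℝ (Fin (m + 1) → ℝ)

instance (m : ℕ) : TopologicalSpace (RP m) :=
  inferInstanceAs (TopologicalSpace (Quotient _))

/-- The basepoint `[1 : 1 : ⋯ : 1]` of `ℝP^m`. -/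
def basept (m : ℕ) : RP m :=
  Projectivization.mk ℝ (fun _ => (1 : ℝ)) (by
    intro h
    exact one_ne_zero (congrFun h 0))

/-- The based loop space `Ω ℝP^m`: continuous maps `ℝP¹ = ℝ ∪ {∞} → ℝP^m`
sending `∞` to the basepoint, with the compact-open topology. -/
abbrev OmegaRP (m : ℕ) := {f : C(OnePoint ℝ, RP m) // f ∞ = basept m}

/-- The set of based loops arising from `(m+1)`-tuples of monic real polynomials of
degree `n` with no common complex root. -/
def RRat (n m : ℕ) : Set (OmegaRP m) :=
  {f | ∃ p : Fin (m + 1) → Polynomial ℝ,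
    (∀ i, (p i).Monic) ∧ (∀ i, (p i).natDegree = n) ∧
    (∀ z : ℂ, ∃ i, Polynomial.aeval z (p i) ≠ 0) ∧
    ∀ x : ℝ, ∃ hx : (fun i => (p i).eval x) ≠ 0,
      f.1 (x : OnePoint ℝ) = Projectivization.mk ℝ (fun i => (p i).eval x) hx}

/-- `rat n m` is the closure of `RRat n m` in `Ω ℝP^m`. -/
def ratSet (n m : ℕ) : Set (OmegaRP m) := closure (RRat n m)

/-! ### The projective plane in the coordinates `(p₀, (p₁ - p₀) + (p₂ - p₀) i)` -/

/-- The vector `(q, q + Re v, q + Im v)` attached to `(q, v)`. -/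
def toVec (w : ℝ × ℂ) : Fin 3 → ℝ := ![w.1, w.1 + w.2.re, w.1 + w.2.im]

/-- The inverse of `toVec`. -/
def ofVec (v : Fin 3 → ℝ) : ℝ × ℂ := (v 0, ⟨v 1 - v 0, v 2 - v 0⟩)

lemma toVec_ofVec (v : Fin 3 → ℝ) : toVec (ofVec v) = v := by
  ext i; fin_cases i <;> simp [toVec, ofVec]

lemma ofVec_toVec (w : ℝ × ℂ) : ofVec (toVec w) = w := by
  refine Prod.ext ?_ (Complex.ext ?_ ?_) <;> simp [toVec, ofVec]

lemma ofVec_smul (c : ℝ) (v : Fin 3 → ℝ) : ofVec (c • v) = c • ofVec v := by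
  refine Prod.ext ?_ (Complex.ext ?_ ?_) <;> simp [ofVec, mul_sub]

lemma toVec_smul (c : ℝ) (w : ℝ × ℂ) : toVec (c • w) = c • toVec w := by
  rw [← toVec_ofVec (c • toVec w), ofVec_smul, ofVec_toVec]

lemma toVec_ne_zero {w : ℝ × ℂ} (hw : w ≠ 0) : toVec w ≠ 0 := by
  intro h
  apply hw
  rw [← ofVec_toVec w, h]
  refine Prod.ext ?_ (Complex.ext ?_ ?_) <;> simp [ofVec]

lemma ofVec_ne_zero {v : Fin 3 → ℝ} (hv : v ≠ 0) : ofVec v ≠ 0 := by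
  intro h
  apply hv
  rw [← toVec_ofVec v, h]
  ext i; fin_cases i <;> simp [toVec]

lemma continuous_toVec : Continuous toVec := by
  refine continuous_pi fun i => ?_
  fin_cases i
  · exact continuous_fst
  · exact continuous_fst.add (Complex.continuous_re.comp continuous_snd)
  · exact continuous_fst.add (Complex.continuous_im.comp continuous_snd)

lemma continuous_ofVec : Continuous ofVec := by
  refine (continuous_apply 0).prodMk ?_
  have h : (fun v : Fin 3 → ℝ => (⟨v 1 - v 0, v 2 - v 0⟩ : ℂ)) =
      fun v => ((v 1 - v 0 : ℝ) : ℂ) + ((v 2 - v 0 : ℝ) : ℂ) * Complex.I := by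
    funext v
    exact Complex.mk_eq_add_mul_I _ _
  rw [h]
  fun_prop

open Classical in
/-- The point `[q : q + Re v : q + Im v]` of the projective plane (the basepoint if
`(q, v) = 0`). -/
def pt (w : ℝ × ℂ) : RP 2 :=
  if h : w = 0 then basept 2 else Projectivization.mk ℝ (toVec w) (toVec_ne_zero h)

lemma pt_of_ne {w : ℝ × ℂ} (h : w ≠ 0) :
    pt w = Projectivization.mk ℝ (toVec w) (toVec_ne_zero h) := dif_neg h

lemma pt_eq_iff {w w' : ℝ × ℂ} (h : w ≠ 0) (h' : w' ≠ 0) :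
    pt w = pt w' ↔ ∃ c : ℝ, w = c • w' := by
  rw [pt_of_ne h, pt_of_ne h', Projectivization.mk_eq_mk_iff']
  refine exists_congr fun c => ?_
  rw [← toVec_smul]
  constructor
  · intro e
    rw [← ofVec_toVec w, ← e, ofVec_toVec]
  · rintro rfl
    rfl

lemma pt_smul {c : ℝ} (hc : c ≠ 0) (w : ℝ × ℂ) : pt (c • w) = pt w := by
  by_cases h : w = 0
  · simp [h]
  · exact (pt_eq_iff (smul_ne_zero hc h) h).2 ⟨c, rfl⟩

lemma exists_pt (p : RP 2) : ∃ w : ℝ × ℂ, w ≠ 0 ∧ p = pt w := by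
  induction p using Projectivization.ind with
  | h v hv =>
    refine ⟨ofVec v, ofVec_ne_zero hv, ?_⟩
    rw [pt_of_ne (ofVec_ne_zero hv)]
    simp only [toVec_ofVec]

lemma pt_real {r : ℝ} (hr : r ≠ 0) : pt (r, 0) = basept 2 := by
  have h : ((r, 0) : ℝ × ℂ) ≠ 0 := by simp [hr]
  rw [pt_of_ne h, basept, Projectivization.mk_eq_mk_iff']
  refine ⟨r, ?_⟩
  ext i; fin_cases i <;> simp [toVec]

lemma pt_eq_basept {w : ℝ × ℂ} (hw : w ≠ 0) (h : pt w = basept 2) : w.2 = 0 := by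
  rw [← pt_real one_ne_zero, pt_eq_iff hw (by simp)] at h
  obtain ⟨c, rfl⟩ := h
  simp

lemma continuous_mk' : Continuous (Projectivization.mk' ℝ : {v : Fin 3 → ℝ // v ≠ 0} → RP 2) :=
  continuous_quot_mk

lemma continuousAt_pt {w : ℝ × ℂ} (hw : w ≠ 0) : ContinuousAt pt w := by
  have h : ContinuousOn pt {w | w ≠ 0} := by
    rw [continuousOn_iff_continuous_domRestrict]
    have : Set.domRestrict {w | w ≠ 0} pt =
        (Projectivization.mk' ℝ : {v : Fin 3 → ℝ // v ≠ 0} → RP 2) ∘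
          fun w : {w : ℝ × ℂ | w ≠ 0} => ⟨toVec w, toVec_ne_zero w.2⟩ := by
      funext w
      exact pt_of_ne w.2
    rw [this]
    exact continuous_mk'.comp
      ((continuous_toVec.comp continuous_subtype_val).subtype_mk _)
  exact h.continuousAt (isOpen_ne.mem_nhds hw)

/-- The locus in the projective plane where a quadratic form is positive. -/
def posLocus (A : ℝ × ℂ → ℝ) : Set (RP 2) := {p | ∃ w ≠ 0, p = pt w ∧ 0 < A w}

lemma pt_mem_posLocus {A : ℝ × ℂ → ℝ} (hA : ∀ (c : ℝ) w, A (c • w) = c ^ 2 * A w)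
    {w : ℝ × ℂ} (hw : w ≠ 0) : pt w ∈ posLocus A ↔ 0 < A w := by
  constructor
  · rintro ⟨w', h', e, hpos⟩
    obtain ⟨c, rfl⟩ := (pt_eq_iff hw h').1 e
    rw [hA]
    have hc : c ≠ 0 := by rintro rfl; simp at hw
    positivity
  · exact fun h => ⟨w, hw, rfl, h⟩

lemma isOpen_posLocus {A : ℝ × ℂ → ℝ} (hA : ∀ (c : ℝ) w, A (c • w) = c ^ 2 * A w)
    (hc : Continuous A) : IsOpen (posLocus A) := by
  change IsOpen ((Projectivization.mk' ℝ : {v : Fin 3 → ℝ // v ≠ 0} → RP 2) ⁻¹' posLocus A)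
  have : (Projectivization.mk' ℝ : {v : Fin 3 → ℝ // v ≠ 0} → RP 2) ⁻¹' posLocus A =
      {v | 0 < A (ofVec v.1)} := by
    ext ⟨v, hv⟩
    have e : (Projectivization.mk' ℝ ⟨v, hv⟩ : RP 2) = pt (ofVec v) := by
      rw [pt_of_ne (ofVec_ne_zero hv)]
      simp only [toVec_ofVec, Projectivization.mk'_eq_mk]
    rw [Set.mem_preimage, e, pt_mem_posLocus hA (ofVec_ne_zero hv)]
    rfl
  rw [this]
  exact isOpen_lt continuous_const (hc.comp (continuous_ofVec.comp continuous_subtype_val))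

/-- A quadratic form in `w'`, positive unless `w` and `w'` are proportional. -/
def crossForm (w w' : ℝ × ℂ) : ℝ :=
  (w.1 * w'.2.re - w'.1 * w.2.re) ^ 2 + (w.1 * w'.2.im - w'.1 * w.2.im) ^ 2 +
    (w.2.re * w'.2.im - w'.2.re * w.2.im) ^ 2

lemma crossForm_pos {w w' : ℝ × ℂ} (hw : w ≠ 0) (hw' : w' ≠ 0) (h : pt w ≠ pt w') :
    0 < crossForm w w' := by
  refine lt_of_le_of_ne (by unfold crossForm; positivity) fun h0 => h ?_
  rw [pt_eq_iff hw hw']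
  obtain ⟨x, y, z⟩ := w
  obtain ⟨x', y', z'⟩ := w'
  simp only [crossForm] at h0
  obtain ⟨⟨h1, h2⟩, h3⟩ : (x * y' - x' * y = 0 ∧ x * z' - x' * z = 0) ∧ y * z' - y' * z = 0 := by
    rw [eq_comm, add_eq_zero_iff_of_nonneg (by positivity) (by positivity),
      add_eq_zero_iff_of_nonneg (by positivity) (by positivity)] at h0
    simpa using h0
  by_cases hx : x' = 0
  · by_cases hy : y' = 0
    · have hz : z' ≠ 0 := by
        rintro rfl
        exact hw' (by subst hx hy; rfl)
      refine ⟨z / z', Prod.ext ?_ (Complex.ext ?_ ?_)⟩ <;> simp <;> field_simp <;> linarith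
    · refine ⟨y / y', Prod.ext ?_ (Complex.ext ?_ ?_)⟩ <;> simp <;> field_simp <;> linarith
  · refine ⟨x / x', Prod.ext ?_ (Complex.ext ?_ ?_)⟩ <;> simp <;> field_simp <;> linarith

lemma crossForm_self (w : ℝ × ℂ) : crossForm w w = 0 := by
  unfold crossForm; ring

instance : T2Space (RP 2) := by
  refine ⟨fun p p' hne => ?_⟩
  obtain ⟨w, hw, rfl⟩ := exists_pt p
  obtain ⟨w', hw', rfl⟩ := exists_pt p'
  have hcont : ∀ w, Continuous (crossForm w) := by
    intro w
    unfold crossForm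
    fun_prop
  have hhom : ∀ w (c : ℝ) w', crossForm w (c • w') = c ^ 2 * crossForm w w' := by
    intro w c w'
    simp only [crossForm, Prod.smul_fst, Prod.smul_snd, smul_eq_mul, Complex.real_smul,
      Complex.mul_re, Complex.mul_im, Complex.ofReal_re, Complex.ofReal_im]
    ring
  have hA : ∀ w w' (c : ℝ) u, crossForm w (c • u) - crossForm w' (c • u) =
      c ^ 2 * (crossForm w u - crossForm w' u) := by
    intro w w' c u
    rw [hhom, hhom]; ring
  refine ⟨posLocus fun u => crossForm w' u - crossForm w u,
    posLocus fun u => crossForm w u - crossForm w' u,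
    isOpen_posLocus (hA _ _) ((hcont _).sub (hcont _)),
    isOpen_posLocus (hA _ _) ((hcont _).sub (hcont _)),
    (pt_mem_posLocus (hA _ _) hw).2 ?_, (pt_mem_posLocus (hA _ _) hw').2 ?_, ?_⟩
  · rw [crossForm_self, sub_zero]
    exact crossForm_pos hw' hw hne.symm
  · rw [crossForm_self, sub_zero]
    exact crossForm_pos hw hw' hne
  · rw [Set.disjoint_left]
    intro x hx hx'
    obtain ⟨u, hu, rfl⟩ := exists_pt x
    rw [pt_mem_posLocus (hA _ _) hu] at hx hx'
    linarith

/-! ### Loops given by coefficients -/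

/-- The quadruple `(μ, β, a, b)` stands for the pair of polynomials
`((t - μ) ^ 2 + β, a (t - μ) + b)`. -/
abbrev Coef := ℝ × ℝ × ℂ × ℂ

/-- The values at `t` of the two polynomials with the given coefficients. -/
def evalCoef (κ : Coef) (t : ℝ) : ℝ × ℂ :=
  ((t - κ.1) ^ 2 + κ.2.1, ((t - κ.1 : ℝ) : ℂ) * κ.2.2.1 + κ.2.2.2)

/-- The coefficients of pairs of polynomials without common real root. -/
def noRealRoot : Set Coef := {κ | ∀ t, evalCoef κ t ≠ 0}

/-- For `β = -r ^ 2 ≤ 0` this is `v(μ + r)` times the conjugate of `v(μ - r)`, where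
`v(t) = a (t - μ) + b`. -/
def xi (κ : Coef) : ℂ :=
  ⟨Complex.normSq κ.2.2.2 + κ.2.1 * Complex.normSq κ.2.2.1,
    2 * √(-κ.2.1) * (κ.2.2.1 * (starRingEnd ℂ) κ.2.2.2).im⟩

lemma continuous_xi : Continuous xi := by
  have h : xi = fun κ : Coef =>
      ((Complex.normSq κ.2.2.2 + κ.2.1 * Complex.normSq κ.2.2.1 : ℝ) : ℂ) +
      ((2 * √(-κ.2.1) * (κ.2.2.1 * (starRingEnd ℂ) κ.2.2.2).im : ℝ) : ℂ) * Complex.I := by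
    funext κ
    exact Complex.mk_eq_add_mul_I _ _
  rw [h]
  have := Complex.continuous_normSq
  fun_prop

lemma mem_noRealRoot_of_pos {κ : Coef} (h : 0 < κ.2.1) : κ ∈ noRealRoot := by
  intro t ht
  have := congrArg Prod.fst ht
  simp only [evalCoef, Prod.fst_zero] at this
  nlinarith [sq_nonneg (t - κ.1)]

lemma mem_noRealRoot_of_xi_ne {κ : Coef} (h : xi κ ≠ 0) : κ ∈ noRealRoot := by
  intro t ht
  apply h
  obtain ⟨μ, β, a, b⟩ := κ
  have h1 := congrArg Prod.fst ht
  have h2 := congrArg Prod.snd ht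
  simp only [evalCoef, Prod.fst_zero, Prod.snd_zero] at h1 h2
  have hb : b = ((-(t - μ) : ℝ) : ℂ) * a := by
    push_cast at h2 ⊢
    linear_combination h2
  have hβ : β = -(t - μ) ^ 2 := by linarith
  simp only [xi]
  subst hb hβ
  apply Complex.ext
  · simp [Complex.normSq_apply]
    ring
  · simp
    right; ring

lemma xi_ne_of_noRealRoot {κ : Coef} (h : κ ∈ noRealRoot) (h0 : κ.2.2 ≠ 0) : xi κ ≠ 0 := by
  obtain ⟨μ, β, a, b⟩ := κ
  intro hx
  have hre := congrArg Complex.re hx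
  have him := congrArg Complex.im hx
  simp only [xi, Complex.zero_re, Complex.zero_im] at hre him
  rcases lt_or_ge 0 β with hβ | hβ
  · apply h0
    have ha := Complex.normSq_nonneg a
    have hb := Complex.normSq_nonneg b
    have hb0 : Complex.normSq b = 0 := by nlinarith [mul_nonneg hβ.le ha]
    have ha0 : Complex.normSq a = 0 := by
      have : β * Complex.normSq a = 0 := by linarith
      simpa [hβ.ne'] using this
    rw [Complex.normSq_eq_zero] at ha0 hb0
    simp [ha0, hb0]
  · obtain ⟨r, hr⟩ : ∃ r, r = √(-β) := ⟨_, rfl⟩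
    have hr2 : r ^ 2 = -β := by rw [hr]; exact Real.sq_sqrt (by linarith)
    rw [← hr] at him
    have hmul : ((r : ℂ) * a + b) * (starRingEnd ℂ) (b - (r : ℂ) * a) = 0 := by
      apply Complex.ext
      · simp [Complex.normSq_apply] at hre ⊢
        have : β = -r ^ 2 := by linarith
        subst this
        linear_combination hre
      · simp only [Complex.mul_im, Complex.conj_re, Complex.conj_im] at him
        simp
        linear_combination him
    rcases mul_eq_zero.1 hmul with h1 | h1
    · refine h (μ + r) (Prod.ext ?_ ?_)
      · simp [evalCoef, hr2]
      · simpa [evalCoef] using h1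
    · rw [map_eq_zero] at h1
      refine h (μ - r) (Prod.ext ?_ ?_)
      · simp [evalCoef, hr2]
      · simp [evalCoef]
        linear_combination h1

/-- The function `1 / (1 + t ^ 2)` on the real projective line. -/
def invQuad : OnePoint ℝ → ℝ := fun t => t.elim 0 fun x => (1 + x ^ 2)⁻¹

/-- The function `t / (1 + t ^ 2)` on the real projective line. -/
def linQuad : OnePoint ℝ → ℝ := fun t => t.elim 0 fun x => x * (1 + x ^ 2)⁻¹

lemma invQuad_coe (x : ℝ) : invQuad x = (1 + x ^ 2)⁻¹ := rfl

lemma linQuad_coe (x : ℝ) : linQuad x = x * (1 + x ^ 2)⁻¹ := rfl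

lemma invQuad_infty : invQuad ∞ = 0 := rfl

lemma linQuad_infty : linQuad ∞ = 0 := rfl

lemma tendsto_abs_inv_cocompact :
    Filter.Tendsto (fun x : ℝ => |x|⁻¹) (Filter.cocompact ℝ) (nhds 0) :=
  tendsto_inv_atTop_zero.comp (tendsto_norm_cocompact_atTop (E := ℝ))

lemma continuous_linQuad : Continuous linQuad := by
  rw [OnePoint.continuous_iff, Filter.coclosedCompact_eq_cocompact]
  constructor
  · refine squeeze_zero_norm (fun x => ?_) tendsto_abs_inv_cocompact
    rw [linQuad_coe, Real.norm_eq_abs, abs_mul, abs_inv, abs_of_pos (by positivity : 0 < 1 + x ^ 2)]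
    rcases eq_or_ne x 0 with rfl | hx
    · simp
    · have : 0 < |x| := abs_pos.2 hx
      rw [← div_eq_mul_inv, div_le_iff₀ (by positivity), ← sq_abs x]
      field_simp
      linarith
  · simp only [linQuad_coe]
    exact continuous_id.mul (Continuous.inv₀ (by fun_prop) fun x => by positivity)

lemma continuous_invQuad : Continuous invQuad := by
  rw [OnePoint.continuous_iff, Filter.coclosedCompact_eq_cocompact]
  constructor
  · refine tendsto_inv_atTop_zero.comp (Filter.tendsto_atTop_mono (fun x => ?_)
      (tendsto_norm_cocompact_atTop (E := ℝ)))
    rw [Real.norm_eq_abs, ← sq_abs x]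
    nlinarith [sq_nonneg (|x| - 1)]
  · simp only [invQuad_coe]
    exact Continuous.inv₀ (by fun_prop) fun x => by positivity

/-- The values of the two polynomials divided by `1 + t ^ 2`, extended to infinity. -/
def normEval (κ : Coef) (t : OnePoint ℝ) : ℝ × ℂ :=
  (1 - invQuad t - 2 * κ.1 * linQuad t + (κ.1 ^ 2 + κ.2.1) * invQuad t,
    ((linQuad t - κ.1 * invQuad t : ℝ) : ℂ) * κ.2.2.1 + (invQuad t : ℂ) * κ.2.2.2)

lemma continuous_normEval : Continuous fun p : Coef × OnePoint ℝ => normEval p.1 p.2 := by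
  have h1 := continuous_linQuad
  have h2 := continuous_invQuad
  unfold normEval
  fun_prop

lemma normEval_infty (κ : Coef) : normEval κ ∞ = (1, 0) := by
  simp [normEval, invQuad_infty, linQuad_infty]

lemma normEval_coe (κ : Coef) (t : ℝ) : normEval κ t = (1 + t ^ 2)⁻¹ • evalCoef κ t := by
  have h : 1 + t ^ 2 ≠ 0 := by positivity
  refine Prod.ext ?_ ?_
  · simp only [normEval, evalCoef, invQuad_coe, linQuad_coe, Prod.smul_fst, smul_eq_mul]
    field_simp
    ring
  · simp only [normEval, evalCoef, invQuad_coe, linQuad_coe, Prod.smul_snd, Complex.real_smul]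
    push_cast
    ring

lemma normEval_ne_zero {κ : Coef} (h : κ ∈ noRealRoot) (t : OnePoint ℝ) : normEval κ t ≠ 0 := by
  induction t using OnePoint.rec with
  | infty => simp [normEval_infty]
  | coe t =>
    rw [normEval_coe]
    exact smul_ne_zero (by positivity) (h t)

lemma pt_normEval_coe (κ : Coef) (t : ℝ) : pt (normEval κ t) = pt (evalCoef κ t) := by
  rw [normEval_coe, pt_smul (by positivity)]

/-- The loop given by a pair of polynomials without common real root. -/
def loopOf (κ : noRealRoot) : OmegaRP 2 :=
  ⟨⟨fun t => pt (normEval κ.1 t), continuous_iff_continuousAt.2 fun t =>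
    (continuousAt_pt (normEval_ne_zero κ.2 t)).comp
      (continuous_normEval.comp (Continuous.prodMk_right κ.1)).continuousAt⟩, by
    change pt (normEval κ.1 ∞) = _
    rw [normEval_infty, pt_real one_ne_zero]⟩

lemma loopOf_coe (κ : noRealRoot) (t : ℝ) : (loopOf κ).1 t = pt (evalCoef κ.1 t) :=
  pt_normEval_coe κ.1 t

lemma continuous_loopOf : Continuous loopOf := by
  refine Continuous.subtype_mk (ContinuousMap.continuous_of_continuous_uncurry _ ?_) _
  refine continuous_iff_continuousAt.2 fun p => ?_
  exact ContinuousAt.comp (f := fun p : noRealRoot × OnePoint ℝ => normEval p.1.1 p.2)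
    (continuousAt_pt (normEval_ne_zero p.1.2 p.2)) (continuous_normEval.comp
      (continuous_subtype_val.prodMap continuous_id)).continuousAt

lemma eq_loopOf {f : OmegaRP 2} {κ : noRealRoot}
    (h : ∀ t : ℝ, f.1 t = pt (evalCoef κ.1 t)) : f = loopOf κ := by
  refine Subtype.ext (ContinuousMap.ext fun t => ?_)
  induction t using OnePoint.rec with
  | infty => rw [f.2, (loopOf κ).2]
  | coe t => rw [h, loopOf_coe]

/-- The constant loop. -/
def constLoop : OmegaRP 2 := ⟨ContinuousMap.const _ (basept 2), rfl⟩

lemma loopOf_eq_constLoop {κ : noRealRoot} (h : κ.1.2.2 = 0) : loopOf κ = constLoop := by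
  refine (eq_loopOf fun t => ?_).symm
  have h0 := κ.2 t
  have e : evalCoef κ.1 t = ((t - κ.1.1) ^ 2 + κ.1.2.1, 0) := by simp [evalCoef, h]
  rw [e] at h0 ⊢
  rw [pt_real fun h => h0 (by rw [h]; rfl)]
  rfl

lemma eq_of_monic_quadratic {p : Polynomial ℝ} (hp : p.Monic) (h2 : p.natDegree = 2) :
    p = Polynomial.X ^ 2 + Polynomial.C (p.coeff 1) * Polynomial.X +
      Polynomial.C (p.coeff 0) := by
  conv_lhs => rw [hp.as_sum, h2]
  simp [Finset.sum_range_succ]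
  ring

lemma natDegree_monic_quadratic (B C : ℝ) :
    (Polynomial.X ^ 2 + Polynomial.C B * Polynomial.X + Polynomial.C C).natDegree = 2 := by
  compute_degree!

lemma monic_quadratic (B C : ℝ) :
    (Polynomial.X ^ 2 + Polynomial.C B * Polynomial.X + Polynomial.C C).Monic := by
  monicity!

lemma toVec_eq (w : ℝ × ℂ) (v : Fin 3 → ℝ) (h0 : v 0 = w.1) (h1 : v 1 = w.1 + w.2.re)
    (h2 : v 2 = w.1 + w.2.im) : toVec w = v := by
  ext i; fin_cases i <;> simp [toVec, h0, h1, h2]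

lemma loopOf_mem_RRat {κ : noRealRoot} (h : κ.1.2.2 ≠ 0) : loopOf κ ∈ RRat 2 2 := by
  obtain ⟨⟨μ, β, a, b⟩, hκ⟩ := κ
  let l : Fin 3 → ℝ := ![0, a.re, a.im]
  let m : Fin 3 → ℝ := ![0, b.re, b.im]
  have hev : ∀ (t : ℝ), toVec (evalCoef (μ, β, a, b) t) = fun i => (Polynomial.X ^ 2 +
      Polynomial.C (l i - 2 * μ) * Polynomial.X +
      Polynomial.C (μ ^ 2 + β + m i - μ * l i)).eval t := by
    intro t
    refine toVec_eq _ _ ?_ ?_ ?_ <;> simp [evalCoef, l, m] <;> ring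
  refine ⟨fun i => Polynomial.X ^ 2 + Polynomial.C (l i - 2 * μ) * Polynomial.X +
    Polynomial.C (μ ^ 2 + β + m i - μ * l i), fun i => monic_quadratic _ _, fun i => natDegree_monic_quadratic _ _,
    fun z => ?_, fun x => ?_⟩
  · by_contra! hz
    have h0 := hz 0
    have h1 := hz 1
    have h2 := hz 2
    simp [l, m] at h0 h1 h2
    have e1 : (a.re : ℂ) * (z - μ) + b.re = 0 := by linear_combination h1 - h0
    have e2 : (a.im : ℂ) * (z - μ) + b.im = 0 := by linear_combination h2 - h0
    have key : z.im ≠ 0 := by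
      intro hzim
      have hzr : z = (z.re : ℂ) := Complex.ext rfl (by simpa using hzim)
      rw [hzr] at h0 e1 e2
      norm_cast at e1 e2
      have h0 : z.re ^ 2 - 2 * μ * z.re + (μ ^ 2 + β) = 0 := by
        have : ((z.re ^ 2 - 2 * μ * z.re + (μ ^ 2 + β) : ℝ) : ℂ) = 0 := by
          push_cast
          linear_combination h0
        exact_mod_cast this
      refine hκ z.re (Prod.ext ?_ (Complex.ext ?_ ?_))
      · simp [evalCoef]; linarith
      · simp [evalCoef]; linarith
      · simp [evalCoef]; linarith
    have i1 := congrArg Complex.im e1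
    have i2 := congrArg Complex.im e2
    simp [key] at i1 i2
    rw [i1] at e1
    rw [i2] at e2
    simp at e1 e2
    apply h
    exact Prod.ext (Complex.ext i1 i2) (Complex.ext e1 e2)
  · refine ⟨(hev x) ▸ toVec_ne_zero (hκ x), ?_⟩
    rw [loopOf_coe, pt_of_ne (hκ x)]
    simp only [hev]

lemma exists_eq_loopOf_of_mem_RRat {f : OmegaRP 2} (hf : f ∈ RRat 2 2) :
    ∃ κ : noRealRoot, κ.1.2.2 ≠ 0 ∧ f = loopOf κ := by
  obtain ⟨p, hm, hd, hroot, hfp⟩ := hf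
  have hp := fun i => eq_of_monic_quadratic (hm i) (hd i)
  set B := fun i => (p i).coeff 1
  set C := fun i => (p i).coeff 0
  let μ := -B 0 / 2
  let a : ℂ := ⟨B 1 - B 0, B 2 - B 0⟩
  let b : ℂ := ⟨C 1 - C 0 + μ * (B 1 - B 0), C 2 - C 0 + μ * (B 2 - B 0)⟩
  have hev : ∀ t : ℝ, toVec (evalCoef (μ, C 0 - μ ^ 2, a, b) t) = fun i => (p i).eval t := by
    intro t
    refine toVec_eq _ _ ?_ ?_ ?_ <;> rw [hp] <;> simp [evalCoef, a, b, μ, B, C] <;> ring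
  have hadm : ((μ, C 0 - μ ^ 2, a, b) : Coef) ∈ noRealRoot := by
    intro t h0
    obtain ⟨hx, -⟩ := hfp t
    apply hx
    rw [← hev, h0]
    ext i; fin_cases i <;> simp [toVec]
  refine ⟨⟨_, hadm⟩, ?_, eq_loopOf fun t => ?_⟩
  · intro hab
    have ha : a = 0 := congrArg Prod.fst hab
    have hb : b = 0 := congrArg Prod.snd hab
    have a1 := congrArg Complex.re ha
    have a2 := congrArg Complex.im ha
    have b1 := congrArg Complex.re hb
    have b2 := congrArg Complex.im hb
    simp only [a, b, Complex.zero_re, Complex.zero_im] at a1 a2 b1 b2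
    rw [a1] at b1
    rw [a2] at b2
    have hall : ∀ i, p i = p 0 := by
      intro i
      rw [hp i, hp 0]
      change _ + Polynomial.C (B i) * _ + Polynomial.C (C i) =
        _ + Polynomial.C (B 0) * _ + Polynomial.C (C 0)
      have hB : B i = B 0 := by fin_cases i <;> simp <;> linarith
      have hC : C i = C 0 := by fin_cases i <;> simp <;> linarith
      rw [hB, hC]
    obtain ⟨z, hz⟩ := IsAlgClosed.exists_aeval_eq_zero ℂ (p 0) (by
      rw [Polynomial.degree_eq_natDegree (hm 0).ne_zero, hd 0]; norm_num)
    obtain ⟨i, hi⟩ := hroot z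
    exact hi (by rw [hall i, hz])
  · obtain ⟨hx, e⟩ := hfp t
    rw [e, pt_of_ne (hadm t)]
    simp only [hev]

/-! ### Limits of loops -/

/-- The values at `t` of `(λ t ^ 2 + B t + C, a t + b)`, where `P = (λ, B, C, a, b)`. -/
def evalPair (P : ℝ × ℝ × ℝ × ℂ × ℂ) (t : ℝ) : ℝ × ℂ :=
  (P.1 * t ^ 2 + P.2.1 * t + P.2.2.1, (t : ℂ) * P.2.2.2.1 + P.2.2.2.2)

/-- The coefficients of the polynomials `((t - μ) ^ 2 + β, a (t - μ) + b)`. -/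
def expand (κ : Coef) : ℝ × ℝ × ℝ × ℂ × ℂ :=
  (1, -2 * κ.1, κ.1 ^ 2 + κ.2.1, κ.2.2.1, κ.2.2.2 - κ.1 * κ.2.2.1)

lemma evalPair_expand (κ : Coef) (t : ℝ) : evalPair (expand κ) t = evalCoef κ t := by
  refine Prod.ext ?_ ?_
  · simp only [evalPair, expand, evalCoef]; ring
  · simp only [evalPair, expand, evalCoef]; push_cast; ring

lemma evalPair_smul (c : ℝ) (P : ℝ × ℝ × ℝ × ℂ × ℂ) (t : ℝ) :
    evalPair (c • P) t = c • evalPair P t := by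
  refine Prod.ext ?_ ?_
  · simp [evalPair]; ring
  · simp [evalPair]; ring

lemma expand_ne_zero (κ : Coef) : expand κ ≠ 0 := fun h =>
  one_ne_zero (congrArg Prod.fst h : (1 : ℝ) = 0)

lemma continuous_evalPair (t : ℝ) : Continuous fun P => evalPair P t := by
  unfold evalPair; fun_prop

lemma exists_limit {ι : Type*} (u : Ultrafilter ι) (k : ι → Coef) (f : OnePoint ℝ → RP 2)
    (h : ∀ t : ℝ, Filter.Tendsto (fun i => pt (evalCoef (k i) t)) u (nhds (f t))) :
    ∃ P ≠ 0, Filter.Tendsto (fun i => ‖expand (k i)‖⁻¹ • expand (k i)) u (nhds P) ∧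
      ∀ t : ℝ, evalPair P t ≠ 0 → f t = pt (evalPair P t) := by
  have hs : ∀ i, ‖expand (k i)‖⁻¹ • expand (k i) ∈
      Metric.sphere (0 : ℝ × ℝ × ℝ × ℂ × ℂ) 1 := by
    intro i
    rw [mem_sphere_zero_iff_norm, norm_smul, norm_inv, norm_norm,
      inv_mul_cancel₀ (norm_ne_zero_iff.2 (expand_ne_zero _))]
  obtain ⟨P, hP, hlim⟩ := (isCompact_sphere (0 : ℝ × ℝ × ℝ × ℂ × ℂ) 1).ultrafilter_le_nhds'
    (u.map fun i => ‖expand (k i)‖⁻¹ • expand (k i)) 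
    (Filter.mem_map.2 (Filter.Eventually.of_forall hs))
  refine ⟨P, ?_, hlim, fun t ht => ?_⟩
  · rintro rfl
    simp at hP
  · have h1 := ((continuousAt_pt ht).tendsto.comp
      ((continuous_evalPair t).continuousAt.tendsto.comp hlim))
    refine tendsto_nhds_unique (h t) (h1.congr fun i => ?_)
    simp only [Function.comp_apply]
    rw [evalPair_smul, pt_smul (inv_ne_zero (norm_ne_zero_iff.2 (expand_ne_zero _))),
      evalPair_expand]

lemma eq_smul_of_proportional {κ : Coef} (hκ : xi κ ≠ 0) {P : ℝ × ℝ × ℝ × ℂ × ℂ}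
    (h : ∀ t : ℝ, ∃ c : ℝ, evalPair P t = c • evalCoef κ t) : P = P.1 • expand κ := by
  have hadm := mem_noRealRoot_of_xi_ne hκ
  have h0 : κ.2.2 ≠ 0 := by
    intro h0
    apply hκ
    simp only [Prod.ext_iff, Prod.fst_zero, Prod.snd_zero] at h0
    apply Complex.ext <;> simp [xi, h0]
  obtain ⟨μ, β, a, b⟩ := κ
  obtain ⟨l, B, C, a', b'⟩ := P
  have key : ∀ s : ℝ, ((l * (s + μ) ^ 2 + B * (s + μ) + C : ℝ) : ℂ) * (a * s + b) =
      ((s ^ 2 + β : ℝ) : ℂ) * (a' * (s + μ) + b') := by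
    intro s
    obtain ⟨c, hc⟩ := h (s + μ)
    have e1 := congrArg Prod.fst hc
    have e2 := congrArg Prod.snd hc
    simp only [evalPair, evalCoef, Prod.smul_fst, Prod.smul_snd, smul_eq_mul,
      Complex.real_smul] at e1 e2
    rw [e1, show a' * (s + μ) + b' = ((s + μ : ℝ) : ℂ) * a' + b' by push_cast; ring, e2]
    push_cast
    ring
  have k0 := key 0
  have k1 := key 1
  have k2 := key (-1)
  have k3 := key 2
  push_cast at k0 k1 k2 k3
  have ha' : a' = l * a := by
    linear_combination (-1/6 : ℂ) * k3 + (1/2 : ℂ) * k1 - (1/2 : ℂ) * k0 + (1/6 : ℂ) * k2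
  have hb' : b' = l * b + (2 * l * μ + B) * a - μ * a' := by
    linear_combination (-1/2 : ℂ) * k1 - (1/2 : ℂ) * k2 + k0
  have hE : (2 * l * μ + B) * b + (l * μ ^ 2 + B * μ + C - β * l) * a = 0 := by
    linear_combination (1/2 : ℂ) * k1 - (1/2 : ℂ) * k2 + (β + 1) * ha'
  have hE' : (l * μ ^ 2 + B * μ + C - β * l) * b - β * (2 * l * μ + B) * a = 0 := by
    linear_combination k0 + β * hb'
  obtain ⟨M, hM⟩ : ∃ M : ℝ, M = 2 * l * μ + B := ⟨_, rfl⟩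
  obtain ⟨E, hEd⟩ : ∃ E : ℝ, E = l * μ ^ 2 + B * μ + C - β * l := ⟨_, rfl⟩
  have hE : (M : ℂ) * b + E * a = 0 := by rw [hM, hEd]; push_cast; exact hE
  have hE' : (E : ℂ) * b - β * M * a = 0 := by rw [hM, hEd]; push_cast; exact hE'
  have hM0 : M = 0 := by
    by_contra hM0
    have hMC : (M : ℂ) ≠ 0 := by exact_mod_cast hM0
    have hb : b = -(E / M : ℝ) * a := by
      push_cast
      field_simp
      linear_combination hE
    have h1 : ((E ^ 2 + β * M ^ 2 : ℝ) : ℂ) * a = 0 := by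
      push_cast
      linear_combination E * hE - M * hE'
    rcases mul_eq_zero.1 h1 with h1 | h1
    · refine hadm (μ + E / M) (Prod.ext ?_ ?_)
      · have h1 : E ^ 2 + β * M ^ 2 = 0 := by exact_mod_cast h1
        simp only [evalCoef, Prod.fst_zero]
        field_simp
        linear_combination h1
      · simp only [evalCoef, Prod.snd_zero, hb]
        push_cast
        ring
    · exact h0 (by rw [hb, h1]; simp)
  have hE0 : E = 0 := by
    by_contra hE0
    have hEC : (E : ℂ) ≠ 0 := by exact_mod_cast hE0
    rw [hM0] at hE hE'
    simp [hEC] at hE hE'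
    exact h0 (by simp [hE, hE'])
  have hB : B = -2 * l * μ := by linarith
  have hC : C = l * (μ ^ 2 + β) := by rw [hE0, hB] at hEd; linarith
  refine Prod.ext ?_ (Prod.ext ?_ (Prod.ext ?_ (Prod.ext ?_ ?_)))
  · simp [expand]
  · simp [expand, hB]; ring
  · simp [expand, hC]
  · simp [expand, ha']
  · simp [expand, hb', ha', hB]; ring

lemma tendsto_of_tendsto_pt {ι : Type*} (u : Ultrafilter ι) (k : ι → Coef) {κ : Coef}
    (hκ : xi κ ≠ 0) (h : ∀ t : ℝ, Filter.Tendsto (fun i => pt (evalCoef (k i) t)) u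
      (nhds (pt (evalCoef κ t)))) : Filter.Tendsto k u (nhds κ) := by
  have hadm := mem_noRealRoot_of_xi_ne hκ
  obtain ⟨P, hP0, hlim, hP⟩ := exists_limit u k (loopOf ⟨κ, hadm⟩).1 (by
    intro t; rw [loopOf_coe]; exact h t)
  have hPκ : P = P.1 • expand κ := by
    refine eq_smul_of_proportional hκ fun t => ?_
    by_cases ht : evalPair P t = 0
    · exact ⟨0, by simp [ht]⟩
    · have := hP t ht
      rw [loopOf_coe] at this
      exact (pt_eq_iff ht (hadm t)).1 this.symm
  have hl : P.1 ≠ 0 := by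
    intro h
    rw [h, zero_smul] at hPκ
    exact hP0 hPκ
  have h1 : Filter.Tendsto (fun i => ‖expand (k i)‖⁻¹) u (nhds P.1) := by
    refine ((continuous_fst.tendsto P).comp hlim).congr fun i => ?_
    simp [expand]
  have h2 : Filter.Tendsto (fun i => expand (k i)) u (nhds (expand κ)) := by
    have h3 := (h1.inv₀ hl).smul hlim
    have e : P.1⁻¹ • P = expand κ := by
      conv_lhs => rw [hPκ]
      rw [smul_smul]
      simp [expand, hl]
    rw [e] at h3
    refine h3.congr fun i => ?_
    rw [inv_inv, smul_smul, mul_inv_cancel₀ (norm_ne_zero_iff.2 (expand_ne_zero _)), one_smul]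
  let contract : ℝ × ℝ × ℝ × ℂ × ℂ → Coef := fun P =>
    (-P.2.1 / 2, P.2.2.1 - (-P.2.1 / 2) ^ 2, P.2.2.2.1, P.2.2.2.2 + (-P.2.1 / 2 : ℝ) * P.2.2.2.1)
  have hc : Continuous contract := by fun_prop
  have he : ∀ κ, contract (expand κ) = κ := by
    intro κ
    refine Prod.ext ?_ (Prod.ext ?_ (Prod.ext ?_ ?_)) <;> simp [contract, expand]
  have h4 := (hc.tendsto _).comp h2
  rw [he] at h4
  exact h4.congr fun i => he _

/-- The coefficients of nonconstant loops. -/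
abbrev Nonconst := {κ : Coef // xi κ ≠ 0}

/-- The loop given by a pair of polynomials without common complex root. -/
def ncLoop (κ : Nonconst) : OmegaRP 2 := loopOf ⟨κ.1, mem_noRealRoot_of_xi_ne κ.2⟩

lemma ncLoop_coe (κ : Nonconst) (t : ℝ) : (ncLoop κ).1 t = pt (evalCoef κ.1 t) :=
  loopOf_coe _ t

lemma snd_snd_ne_zero {κ : Coef} (h : xi κ ≠ 0) : κ.2.2 ≠ 0 := by
  intro h0
  apply h
  simp only [Prod.ext_iff, Prod.fst_zero, Prod.snd_zero] at h0
  apply Complex.ext <;> simp [xi, h0]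

lemma range_ncLoop : Set.range ncLoop = RRat 2 2 := by
  ext f
  constructor
  · rintro ⟨κ, rfl⟩
    exact loopOf_mem_RRat (snd_snd_ne_zero κ.2)
  · intro hf
    obtain ⟨κ, h, rfl⟩ := exists_eq_loopOf_of_mem_RRat hf
    exact ⟨⟨κ.1, xi_ne_of_noRealRoot κ.2 h⟩, rfl⟩

lemma continuous_ncLoop : Continuous ncLoop :=
  continuous_loopOf.comp (continuous_subtype_val.subtype_mk _)

lemma continuous_eval_loop (t : OnePoint ℝ) : Continuous fun f : OmegaRP 2 => f.1 t :=
  (continuous_eval_const t).comp continuous_subtype_val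

lemma tendsto_of_tendsto_ncLoop {ι : Type*} (u : Ultrafilter ι) (k : ι → Nonconst) {κ : Nonconst}
    (h : Filter.Tendsto (fun i => ncLoop (k i)) u (nhds (ncLoop κ))) :
    Filter.Tendsto k u (nhds κ) := by
  rw [tendsto_subtype_rng]
  refine tendsto_of_tendsto_pt u _ κ.2 fun t => ?_
  have := ((continuous_eval_loop (t : OnePoint ℝ)).tendsto _).comp h
  simpa only [ncLoop_coe, Function.comp_def] using this

lemma isEmbedding_ncLoop : Topology.IsEmbedding ncLoop := by
  refine ⟨Topology.isInducing_iff_nhds.2 fun κ => le_antisymm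
    (continuous_ncLoop.tendsto κ).le_comap ?_, fun κ κ' h => ?_⟩
  · rw [Filter.le_iff_ultrafilter]
    intro u hu
    exact tendsto_of_tendsto_ncLoop u id (Filter.tendsto_iff_comap.2 hu)
  · have := tendsto_of_tendsto_ncLoop (pure κ) id (κ := κ') (by
      rw [Ultrafilter.coe_pure, ← h]
      exact tendsto_pure_nhds _ _)
    rw [Ultrafilter.coe_pure, Filter.tendsto_pure_left] at this
    exact (specializes_iff_pure.2 (by simpa [Filter.pure_le_iff] using this)).eq

/-! ### The closure of the set of rational loops -/

lemma loop_ext_of_finite {f g : OmegaRP 2} {S : Set ℝ} (hS : S.Finite)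
    (h : ∀ t : ℝ, t ∉ S → f.1 t = g.1 t) : f = g := by
  refine Subtype.ext (ContinuousMap.ext fun t => ?_)
  induction t using OnePoint.rec with
  | infty => rw [f.2, g.2]
  | coe t =>
    have hf : ∀ f : OmegaRP 2, Filter.Tendsto (fun s : ℝ => f.1 s) (nhdsWithin t {t}ᶜ)
        (nhds (f.1 t)) := fun f =>
      ((f.1.continuous.comp OnePoint.continuous_coe).tendsto t).mono_left nhdsWithin_le_nhds
    refine tendsto_nhds_unique ((hf f).congr' ?_) (hf g)
    filter_upwards [nhdsNE_le_cofinite t hS.compl_mem_cofinite] with s hs using h s hs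

lemma tendsto_loop_atTop (f : OmegaRP 2) :
    Filter.Tendsto (fun s : ℝ => f.1 s) Filter.atTop (nhds (basept 2)) := by
  have h := f.1.continuous.tendsto ∞
  rw [f.2] at h
  refine h.comp ?_
  refine (OnePoint.tendsto_coe_infty (X := ℝ)).mono_left ?_
  rw [Filter.coclosedCompact_eq_cocompact]
  exact atTop_le_cocompact

lemma sq_add_pos_of_ne {μ β z : ℝ} (h : ∀ t, t ∉ Set.Ioo (z - 1) (z + 1) → (t - μ) ^ 2 + β ≠ 0)
    {t : ℝ} (ht : t = z - 1 ∨ t = z + 1) : 0 < (t - μ) ^ 2 + β := by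
  by_contra hneg
  have hβ : 0 ≤ -β := by nlinarith [sq_nonneg (t - μ)]
  have hr := Real.sq_sqrt hβ
  have hle : |t - μ| ≤ √(-β) := Real.abs_le_sqrt (by linarith)
  have h2 := abs_le.1 hle
  rcases ht with rfl | rfl
  · refine h (μ - √(-β)) (fun hm => ?_) (by ring_nf; ring_nf at hr; linarith)
    linarith [hm.1]
  · refine h (μ + √(-β)) (fun hm => ?_) (by ring_nf; ring_nf at hr; linarith)
    linarith [hm.2]

lemma not_linear_of_mem_closure {f : OmegaRP 2} (hf : f ∈ closure (RRat 2 2)) {z : ℝ} {a : ℂ}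
    (ha : a ≠ 0) (h : ∀ t : ℝ, f.1 t = pt (t - z, a)) : False := by
  have hna : 0 < Complex.normSq a := Complex.normSq_pos.2 ha
  let W : ℂ → ℝ := fun v => v.re * a.re + v.im * a.im
  have hWc : Continuous W := by fun_prop
  have hWs : ∀ (c : ℝ) (w : ℂ), W (c • w) = c * W w := fun c w => by simp [W]; ring
  have hWa : W a = Complex.normSq a := by simp [W, Complex.normSq_apply]
  let A1 : ℝ × ℂ → ℝ := fun w => w.1 ^ 2
  let A2 : ℝ × ℂ → ℝ := fun w => W w.2 ^ 2
  let A3 : ℝ × ℂ → ℝ := fun w => w.1 * W w.2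
  let A4 : ℝ × ℂ → ℝ := fun w => -(w.1 * W w.2)
  have h1 : ∀ (c : ℝ) w, A1 (c • w) = c ^ 2 * A1 w := fun c w => by simp [A1]; ring
  have h2 : ∀ (c : ℝ) w, A2 (c • w) = c ^ 2 * A2 w := fun c w => by
    simp only [A2, Prod.smul_snd, hWs]; ring
  have h3 : ∀ (c : ℝ) w, A3 (c • w) = c ^ 2 * A3 w := fun c w => by
    simp only [A3, Prod.smul_snd, hWs, Prod.smul_fst, smul_eq_mul]; ring
  have h4 : ∀ (c : ℝ) w, A4 (c • w) = c ^ 2 * A4 w := fun c w => by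
    simp only [A4, Prod.smul_snd, hWs, Prod.smul_fst, smul_eq_mul]; ring
  have c1 : Continuous A1 := by fun_prop
  have c2 : Continuous A2 := by fun_prop
  have c3 : Continuous A3 := by fun_prop
  have c4 : Continuous A4 := by fun_prop
  let K1 : Set (OnePoint ℝ) := ((↑) '' Set.Ioo (z - 1) (z + 1))ᶜ
  let K2 : Set (OnePoint ℝ) := (↑) '' Set.Icc (z - 1) (z + 1)
  have hK1 : IsCompact K1 :=
    (OnePoint.isOpenEmbedding_coe.isOpenMap _ isOpen_Ioo).isClosed_compl.isCompact
  have hK2 : IsCompact K2 := isCompact_Icc.image OnePoint.continuous_coe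
  let U : Set (OmegaRP 2) := {g | Set.MapsTo g.1 K1 (posLocus A1) ∧
    Set.MapsTo g.1 K2 (posLocus A2) ∧ g.1 ((z + 1 : ℝ) : OnePoint ℝ) ∈ posLocus A3 ∧
    g.1 ((z - 1 : ℝ) : OnePoint ℝ) ∈ posLocus A4}
  have hU : IsOpen U := by
    refine IsOpen.inter ?_ (IsOpen.inter ?_ (IsOpen.inter ?_ ?_))
    · exact (ContinuousMap.isOpen_setOfPred_mapsTo hK1 (isOpen_posLocus h1 c1)).preimage
        continuous_subtype_val
    · exact (ContinuousMap.isOpen_setOfPred_mapsTo hK2 (isOpen_posLocus h2 c2)).preimage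
        continuous_subtype_val
    · exact (isOpen_posLocus h3 c3).preimage (continuous_eval_loop _)
    · exact (isOpen_posLocus h4 c4).preimage (continuous_eval_loop _)
  have hne : ∀ t : ℝ, (t - z, a) ≠ (0 : ℝ × ℂ) := fun t ht => ha (congrArg Prod.snd ht)
  have hfU : f ∈ U := by
    refine ⟨fun t ht => ?_, ?_, ?_, ?_⟩
    · induction t using OnePoint.rec with
      | infty =>
        rw [f.2, ← pt_real one_ne_zero, pt_mem_posLocus h1 (by simp)]
        simp [A1]
      | coe t =>
        rw [h, pt_mem_posLocus h1 (hne t)]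
        refine sq_pos_of_ne_zero fun h0 => ht (Set.mem_image_of_mem _ ?_)
        change t - z = 0 at h0
        exact ⟨by linarith, by linarith⟩
    · rintro _ ⟨t, -, rfl⟩
      rw [h, pt_mem_posLocus h2 (hne t)]
      simp only [A2, hWa]
      positivity
    · rw [h, pt_mem_posLocus h3 (hne _)]
      simpa only [A3, hWa, add_sub_cancel_left, one_mul]
    · rw [h, pt_mem_posLocus h4 (hne _)]
      simp only [A4, hWa]
      linarith
  obtain ⟨g, hgU, hg⟩ := mem_closure_iff.1 hf U hU hfU
  rw [← range_ncLoop] at hg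
  obtain ⟨κ, rfl⟩ := hg
  obtain ⟨g1, g2, g3, g4⟩ := hgU
  have hadm := mem_noRealRoot_of_xi_ne κ.2
  have q1 : ∀ t, t ∉ Set.Ioo (z - 1) (z + 1) → (t - κ.1.1) ^ 2 + κ.1.2.1 ≠ 0 := by
    intro t ht h0
    have := g1 (x := (t : OnePoint ℝ)) (by
      rintro ⟨s, hs, e⟩
      exact ht (OnePoint.coe_injective e ▸ hs))
    rw [ncLoop_coe, pt_mem_posLocus h1 (hadm t)] at this
    simp [A1, evalCoef, h0] at this
  have q2 : ∀ t ∈ Set.Icc (z - 1) (z + 1), W (evalCoef κ.1 t).2 ≠ 0 := by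
    intro t ht h0
    have := g2 (Set.mem_image_of_mem _ ht)
    rw [ncLoop_coe, pt_mem_posLocus h2 (hadm t)] at this
    simp [A2, h0] at this
  rw [ncLoop_coe, pt_mem_posLocus h3 (hadm _)] at g3
  rw [ncLoop_coe, pt_mem_posLocus h4 (hadm _)] at g4
  have p3 : 0 < W (evalCoef κ.1 (z + 1)).2 :=
    pos_of_mul_pos_right g3 (sq_add_pos_of_ne q1 (Or.inr rfl)).le
  have p4 : W (evalCoef κ.1 (z - 1)).2 < 0 := by
    have := sq_add_pos_of_ne q1 (Or.inl rfl)
    by_contra hn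
    have : 0 ≤ (evalCoef κ.1 (z - 1)).1 * W (evalCoef κ.1 (z - 1)).2 :=
      mul_nonneg this.le (not_lt.1 hn)
    simp only [A4] at g4
    linarith
  have hcont : Continuous fun t => W (evalCoef κ.1 t).2 := by
    unfold evalCoef; fun_prop
  obtain ⟨t, ht, ht0⟩ := intermediate_value_Icc (by linarith : z - 1 ≤ z + 1) hcont.continuousOn
    (⟨p4.le, p3.le⟩ : (0 : ℝ) ∈ Set.Icc _ _)
  exact q2 t ht ht0

lemma eq_constLoop_of_linear {f : OmegaRP 2} (hf : f ∈ closure (RRat 2 2)) {B C : ℝ} {a b : ℂ}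
    (hP : (0, B, C, a, b) ≠ (0 : ℝ × ℝ × ℝ × ℂ × ℂ)) {z : ℝ}
    (h : ∀ t ≠ z, evalPair (0, B, C, a, b) t ≠ 0 → f.1 t = pt (evalPair (0, B, C, a, b) t)) :
    f = constLoop := by
  have hlim := tendsto_loop_atTop f
  by_cases hBa : (B, a) = (0 : ℝ × ℂ)
  · simp only [Prod.mk_eq_zero] at hBa
    obtain ⟨rfl, rfl⟩ := hBa
    have hCb : (C, b) ≠ (0 : ℝ × ℂ) := by
      intro h0
      simp only [Prod.mk_eq_zero] at h0
      simp [h0] at hP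
    have h1 : ∀ t ≠ z, f.1 t = pt (C, b) := by
      intro t ht
      have := h t ht (by simpa [evalPair] using hCb)
      simpa [evalPair] using this
    have h2 : pt (C, b) = basept 2 := by
      refine tendsto_nhds_unique (tendsto_const_nhds.congr' ?_) hlim
      filter_upwards [Filter.eventually_ne_atTop z] with t ht using (h1 t ht).symm
    exact loop_ext_of_finite (Set.finite_singleton z) fun t ht => (h1 t ht).trans h2
  · have h1 : Filter.Tendsto (fun t : ℝ => t⁻¹ • evalPair (0, B, C, a, b) t) Filter.atTop
        (nhds (B, a)) := by
      have hi : Filter.Tendsto (fun t : ℝ => t⁻¹) Filter.atTop (nhds 0) := tendsto_inv_atTop_zero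
      have : Filter.Tendsto (fun t : ℝ => (B, a) + t⁻¹ • (C, b)) Filter.atTop
          (nhds ((B, a) + (0 : ℝ) • (C, b))) := tendsto_const_nhds.add (hi.smul_const _)
      rw [zero_smul, add_zero] at this
      refine this.congr' ?_
      filter_upwards [Filter.eventually_ne_atTop 0] with t ht
      have htc : (t : ℂ) ≠ 0 := by exact_mod_cast ht
      refine Prod.ext ?_ ?_
      · simp [evalPair]; field_simp
      · simp [evalPair]; field_simp
    have h2 : pt (B, a) = basept 2 := by
      refine tendsto_nhds_unique (((continuousAt_pt hBa).tendsto.comp h1).congr' ?_) hlim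
      filter_upwards [Filter.eventually_ne_atTop z, Filter.eventually_ne_atTop 0,
        h1.eventually_ne hBa] with t ht ht0 hne
      rw [Function.comp_apply, pt_smul (inv_ne_zero ht0)]
      refine (h t ht fun h0 => hne ?_).symm
      rw [h0, smul_zero]
    have ha : a = 0 := pt_eq_basept hBa h2
    subst ha
    have hB : B ≠ 0 := by
      rintro rfl
      exact hBa rfl
    by_cases hb : b = 0
    · subst hb
      refine loop_ext_of_finite (S := {z, -C / B}) (Set.toFinite _) fun t ht => ?_
      simp only [Set.mem_insert_iff, Set.mem_singleton_iff, not_or] at ht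
      have hne : B * t + C ≠ 0 := by
        intro h0
        apply ht.2
        field_simp
        linarith
      have e : evalPair (0, B, C, 0, 0) t = (B * t + C, 0) := by simp [evalPair]
      rw [h t ht.1 (by rw [e]; simpa using hne), e]
      exact pt_real hne
    · exfalso
      have hb' : b / B ≠ 0 := div_ne_zero hb (by exact_mod_cast hB)
      have e : ∀ t : ℝ, evalPair (0, B, C, 0, b) t = B • (t - -C / B, b / B) := by
        intro t
        have hBc : (B : ℂ) ≠ 0 := by exact_mod_cast hB
        refine Prod.ext ?_ ?_
        · simp [evalPair]; field_simp; ring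
        · simp [evalPair]; field_simp
      have hne : ∀ t : ℝ, (t - -C / B, b / B) ≠ (0 : ℝ × ℂ) :=
        fun t ht => hb' (congrArg Prod.snd ht)
      refine not_linear_of_mem_closure hf hb' (z := -C / B) fun t => ?_
      have k1 : Filter.Tendsto (fun s : ℝ => f.1 s) (nhdsWithin t {t}ᶜ) (nhds (f.1 t)) :=
        ((f.1.continuous.comp OnePoint.continuous_coe).tendsto t).mono_left nhdsWithin_le_nhds
      have k2 : Filter.Tendsto (fun s : ℝ => pt (s - -C / B, b / B)) (nhdsWithin t {t}ᶜ)
          (nhds (pt (t - -C / B, b / B))) :=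
        ((ContinuousAt.comp (f := fun s : ℝ => ((s - -C / B, b / B) : ℝ × ℂ))
          (continuousAt_pt (hne t)) (by fun_prop)).tendsto).mono_left nhdsWithin_le_nhds
      refine tendsto_nhds_unique (k1.congr' ?_) k2
      filter_upwards [nhdsNE_le_cofinite t (Set.finite_singleton z).compl_mem_cofinite] with s hs
      rw [h s hs (by rw [e]; exact smul_ne_zero hB (hne s)), e, pt_smul hB]

lemma eq_constLoop_or_mem_RRat {f : OmegaRP 2} (hf : f ∈ closure (RRat 2 2)) :
    f = constLoop ∨ f ∈ RRat 2 2 := by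
  have hfr := mem_closure_iff_frequently.1 hf
  rw [← range_ncLoop] at hfr
  have hN : (Filter.comap ncLoop (nhds f)).NeBot := Filter.comap_neBot_iff_frequently.2 hfr
  have hu : Filter.Tendsto ncLoop (Ultrafilter.of (Filter.comap ncLoop (nhds f))) (nhds f) :=
    Filter.tendsto_iff_comap.2 (Ultrafilter.of_le _)
  obtain ⟨P, hP0, -, hP⟩ := exists_limit (Ultrafilter.of (Filter.comap ncLoop (nhds f)))
    (fun κ => κ.1) f.1 fun t => by
      simpa only [Function.comp_def, ncLoop_coe] using
        ((continuous_eval_loop (t : OnePoint ℝ)).tendsto f).comp hu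
  obtain ⟨l, B, C, a, b⟩ := P
  by_cases hl : l = 0
  · subst hl
    exact Or.inl (eq_constLoop_of_linear hf hP0 (z := 0) fun t _ => hP t)
  have hlc : (l : ℂ) ≠ 0 := by exact_mod_cast hl
  obtain ⟨μ, hμ⟩ : ∃ μ : ℝ, B = -2 * l * μ := ⟨-B / (2 * l), by field_simp⟩
  obtain ⟨β, hβ⟩ : ∃ β : ℝ, C = l * (μ ^ 2 + β) := ⟨C / l - μ ^ 2, by field_simp; ring⟩
  have e : ∀ t, evalPair (l, B, C, a, b) t = l • evalCoef (μ, β, a / l, (b + μ * a) / l) t := by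
    intro t
    refine Prod.ext ?_ ?_
    · simp only [evalPair, evalCoef, hμ, hβ, Prod.smul_fst, smul_eq_mul]; ring
    · simp only [evalPair, evalCoef, Prod.smul_snd, Complex.real_smul]
      push_cast
      field_simp
      ring
  by_cases hadm : (μ, β, a / l, (b + μ * a) / l) ∈ noRealRoot
  · have hfe : f = loopOf ⟨_, hadm⟩ := eq_loopOf fun t => by
      rw [hP t (by rw [e]; exact smul_ne_zero hl (hadm t)), e, pt_smul hl]
    by_cases h0 : (a / l, (b + μ * a) / l) = (0 : ℂ × ℂ)
    · exact Or.inl (hfe.trans (loopOf_eq_constLoop h0))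
    · exact Or.inr (hfe ▸ loopOf_mem_RRat h0)
  · simp only [noRealRoot, Set.mem_ofPred_eq, not_forall, not_not] at hadm
    obtain ⟨z, hz⟩ := hadm
    obtain ⟨α, hα⟩ : ∃ α, α = a / l := ⟨_, rfl⟩
    obtain ⟨γ, hγ⟩ : ∃ γ, γ = (b + μ * a) / l := ⟨_, rfl⟩
    rw [← hα, ← hγ] at hz e
    have z1 : (z - μ) ^ 2 + β = 0 := congrArg Prod.fst hz
    have z2 : ((z - μ : ℝ) : ℂ) * α + γ = 0 := congrArg Prod.snd hz
    have e2 : ∀ t, evalPair (l, B, C, a, b) t =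
        (l * (t - z)) • evalPair (0, 1, z - 2 * μ, 0, α) t := by
      intro t
      rw [e, mul_smul]
      congr 1
      refine Prod.ext ?_ ?_
      · simp only [evalPair, evalCoef, Prod.smul_fst, smul_eq_mul]; linear_combination z1
      · simp only [evalPair, evalCoef, Prod.smul_snd, Complex.real_smul]
        push_cast at z2 ⊢
        linear_combination z2
    refine Or.inl (eq_constLoop_of_linear hf (B := 1) (C := z - 2 * μ) (a := 0) (b := α)
      (by simp) (z := z) fun t ht hne => ?_)
    have hlt : l * (t - z) ≠ 0 := mul_ne_zero hl (sub_ne_zero.2 ht)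
    rw [hP t (by rw [e2]; exact smul_ne_zero hlt hne), e2, pt_smul hlt]

lemma constLoop_mem_ratSet : constLoop ∈ ratSet 2 2 := by
  let γ : ℝ → noRealRoot := fun ε => ⟨(0, 1, 0, (ε : ℂ)), mem_noRealRoot_of_pos one_pos⟩
  have hγ : Continuous γ := by
    refine Continuous.subtype_mk ?_ _
    fun_prop
  have h0 : loopOf (γ 0) = constLoop := loopOf_eq_constLoop (by simp [γ])
  have hlim : Filter.Tendsto (fun ε => loopOf (γ ε)) (nhdsWithin 0 {0}ᶜ) (nhds constLoop) := by
    rw [← h0]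
    exact ((continuous_loopOf.comp hγ).tendsto 0).mono_left nhdsWithin_le_nhds
  refine mem_closure_of_tendsto hlim ?_
  filter_upwards [self_mem_nhdsWithin] with ε hε
  refine loopOf_mem_RRat ?_
  simpa [γ] using hε

lemma loopOf_mem_ratSet (κ : noRealRoot) : loopOf κ ∈ ratSet 2 2 := by
  by_cases h : κ.1.2.2 = 0
  · rw [loopOf_eq_constLoop h]
    exact constLoop_mem_ratSet
  · exact subset_closure (loopOf_mem_RRat h)

/-- The loop `loopOf κ` as a point of `ratSet 2 2`. -/
def loopIn (κ : noRealRoot) : ratSet 2 2 := ⟨loopOf κ, loopOf_mem_ratSet κ⟩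

/-- The constant loop as a point of `ratSet 2 2`. -/
def constIn : ratSet 2 2 := ⟨constLoop, constLoop_mem_ratSet⟩

/-- The loop `ncLoop κ` as a point of `ratSet 2 2`. -/
def ncIn (κ : Nonconst) : ratSet 2 2 := loopIn ⟨κ.1, mem_noRealRoot_of_xi_ne κ.2⟩

lemma continuous_loopIn : Continuous loopIn := continuous_loopOf.subtype_mk _

lemma loopIn_eq_constIn {κ : noRealRoot} (h : κ.1.2.2 = 0) : loopIn κ = constIn :=
  Subtype.ext (loopOf_eq_constLoop h)

lemma ncLoop_ne_constLoop (κ : Nonconst) : ncLoop κ ≠ constLoop := by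
  intro h
  have hv : ∀ t : ℝ, (evalCoef κ.1 t).2 = 0 := by
    intro t
    refine pt_eq_basept (mem_noRealRoot_of_xi_ne κ.2 t) ?_
    rw [← ncLoop_coe, h]
    rfl
  have h0 := hv κ.1.1
  have h1 := hv (κ.1.1 + 1)
  simp only [evalCoef, sub_self, Complex.ofReal_zero, zero_mul, zero_add] at h0
  simp only [evalCoef, add_sub_cancel_left, Complex.ofReal_one, one_mul, h0, add_zero] at h1
  exact snd_snd_ne_zero κ.2 (Prod.ext h1 h0)

lemma ncIn_ne_constIn (κ : Nonconst) : ncIn κ ≠ constIn := fun h =>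
  ncLoop_ne_constLoop κ (congrArg Subtype.val h)

lemma eq_constIn_or_eq_ncIn (f : ratSet 2 2) : f = constIn ∨ ∃ κ, ncIn κ = f := by
  rcases eq_constLoop_or_mem_RRat f.2 with h | h
  · exact Or.inl (Subtype.ext h)
  · rw [← range_ncLoop] at h
    obtain ⟨κ, h⟩ := h
    exact Or.inr ⟨κ, Subtype.ext h⟩

lemma constIn_notMem_range : ¬ ∃ κ, ncIn κ = constIn := fun ⟨κ, h⟩ => ncIn_ne_constIn κ h

lemma isOpenEmbedding_ncIn : Topology.IsOpenEmbedding ncIn := by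
  refine ⟨isEmbedding_ncLoop.codRestrict (ratSet 2 2) _, ?_⟩
  have : Set.range ncIn = {constIn}ᶜ := by
    ext f
    constructor
    · rintro ⟨κ, rfl⟩
      exact ncIn_ne_constIn κ
    · intro h
      exact (eq_constIn_or_eq_ncIn f).resolve_left h
  rw [this]
  exact isOpen_compl_singleton

/-- The quadratic form `ε ^ 2 q ^ 2 - ‖v‖ ^ 2` at `(q, v)`. -/
def coneForm (ε : ℝ) (w : ℝ × ℂ) : ℝ := ε ^ 2 * w.1 ^ 2 - Complex.normSq w.2

lemma coneForm_smul (ε c : ℝ) (w : ℝ × ℂ) : coneForm ε (c • w) = c ^ 2 * coneForm ε w := by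
  simp [coneForm, Complex.normSq_mul]; ring

lemma continuous_coneForm (ε : ℝ) : Continuous (coneForm ε) := by
  have := Complex.continuous_normSq
  unfold coneForm
  fun_prop

/-- The loops contained in a neighbourhood of the basepoint. -/
def nearConst (ε : ℝ) : Set (ratSet 2 2) := {f | ∀ t, f.1.1 t ∈ posLocus (coneForm ε)}

lemma nearConst_mem_nhds {ε : ℝ} (hε : 0 < ε) : nearConst ε ∈ nhds constIn := by
  have ho : IsOpen (nearConst ε) := by
    have := ((ContinuousMap.isOpen_setOfPred_mapsTo (X := OnePoint ℝ) isCompact_univ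
      (isOpen_posLocus (coneForm_smul ε) (continuous_coneForm ε))).preimage
        continuous_subtype_val).preimage (continuous_subtype_val (p := (· ∈ ratSet 2 2)))
    convert this using 1
    ext f
    exact ⟨fun h t _ => h t, fun h t => h trivial⟩
  refine ho.mem_nhds fun t => ?_
  change basept 2 ∈ _
  rw [← pt_real one_ne_zero, pt_mem_posLocus (coneForm_smul ε) (by simp)]
  simpa [coneForm] using pow_pos hε 2

lemma of_ncIn_mem_nearConst {ε : ℝ} (hε : 0 < ε) {κ : Nonconst} (h : ncIn κ ∈ nearConst ε) :
    0 < κ.1.2.1 ∧ ∀ t : ℝ, ‖((t : ℝ) : ℂ) * κ.1.2.2.1 + κ.1.2.2.2‖ ≤ ε * (t ^ 2 + κ.1.2.1) := by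
  have hadm := mem_noRealRoot_of_xi_ne κ.2
  have key : ∀ t : ℝ, 0 < coneForm ε (evalCoef κ.1 t) := by
    intro t
    have := h (t : OnePoint ℝ)
    change (ncLoop κ).1 t ∈ _ at this
    rwa [ncLoop_coe, pt_mem_posLocus (coneForm_smul ε) (hadm t)] at this
  have hβ : 0 < κ.1.2.1 := by
    by_contra hneg
    have hr := Real.sq_sqrt (by linarith : 0 ≤ -κ.1.2.1)
    have := key (κ.1.1 + √(-κ.1.2.1))
    simp only [coneForm, evalCoef, add_sub_cancel_left, hr] at this
    have h2 := Complex.normSq_nonneg (((√(-κ.1.2.1) : ℝ) : ℂ) * κ.1.2.2.1 + κ.1.2.2.2)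
    rw [neg_add_cancel] at this
    norm_num at this
    linarith
  refine ⟨hβ, fun t => ?_⟩
  have := key (κ.1.1 + t)
  simp only [coneForm, evalCoef, add_sub_cancel_left, Complex.normSq_eq_norm_sq] at this
  refine abs_le_of_sq_le_sq' ?_ (by positivity) |>.2
  rw [mul_pow]
  linarith

lemma exists_cone_subset {U : Set (RP 2)} (hU : U ∈ nhds (basept 2)) :
    ∃ ε > 0, ∀ w : ℝ × ℂ, ‖w.2‖ < ε * w.1 → pt w ∈ U := by
  have h1 : ((1, 0) : ℝ × ℂ) ≠ 0 := by simp
  have hc : ContinuousAt (fun v : ℂ => pt (1, v)) 0 :=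
    ContinuousAt.comp (f := fun v : ℂ => ((1, v) : ℝ × ℂ)) (continuousAt_pt h1) (by fun_prop)
  have := hc.preimage_mem_nhds (by rw [pt_real one_ne_zero]; exact hU)
  obtain ⟨ε, hε, hball⟩ := Metric.mem_nhds_iff.1 this
  refine ⟨ε, hε, fun w hw => ?_⟩
  have hq : 0 < w.1 := by
    by_contra hn
    nlinarith [norm_nonneg w.2]
  have h2 : pt (1, w.1⁻¹ • w.2) ∈ U := hball (by
    rw [mem_ball_zero_iff, norm_smul, norm_inv, Real.norm_of_nonneg hq.le, inv_mul_lt_iff₀ hq]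
    linarith)
  have e : w = w.1 • ((1, w.1⁻¹ • w.2) : ℝ × ℂ) := by
    refine Prod.ext (by simp) ?_
    rw [Prod.smul_snd, smul_smul, mul_inv_cancel₀ hq.ne', one_smul]
  rw [e, pt_smul hq.ne']
  exact h2

/-! ### The pinched torus -/

/-- The direction of a complex number. -/
def dir (a : ℂ) : ℂ := a / (‖a‖ : ℝ)

lemma dir_zero : dir 0 = 0 := by simp [dir]

lemma norm_dir {a : ℂ} (ha : a ≠ 0) : ‖dir a‖ = 1 := by
  rw [dir, norm_div, Complex.norm_real, norm_norm, div_self (norm_ne_zero_iff.2 ha)]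

lemma dir_of_norm_one {a : ℂ} (ha : ‖a‖ = 1) : dir a = a := by simp [dir, ha]

lemma norm_mul_dir (a : ℂ) : (‖a‖ : ℂ) * dir a = a := by
  by_cases ha : a = 0
  · simp [ha]
  · rw [dir, mul_div_cancel₀]
    exact_mod_cast norm_ne_zero_iff.2 ha

lemma dir_mul_of_pos {r : ℝ} (hr : 0 < r) (a : ℂ) : dir (r * a) = dir a := by
  have : (r : ℂ) ≠ 0 := by exact_mod_cast hr.ne'
  rw [dir, dir, norm_mul, Complex.norm_real, Real.norm_of_nonneg hr.le, Complex.ofReal_mul,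
    mul_div_mul_left _ _ this]

lemma dir_of_pos {a : ℂ} (him : a.im = 0) (hre : 0 < a.re) : dir a = 1 := by
  have e : a = ((a.re : ℝ) : ℂ) * 1 := by apply Complex.ext <;> simp [him]
  rw [e, dir_mul_of_pos hre, dir_of_norm_one norm_one]

lemma continuousAt_dir {a : ℂ} (ha : a ≠ 0) : ContinuousAt dir a := by
  have : ((‖a‖ : ℝ) : ℂ) ≠ 0 := by exact_mod_cast norm_ne_zero_iff.2 ha
  unfold dir
  fun_prop (disch := assumption)

lemma norm_dir_le (a : ℂ) : ‖dir a‖ ≤ 1 := by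
  by_cases ha : a = 0
  · simp [ha, dir_zero]
  · exact (norm_dir ha).le

lemma continuousAt_mul_dir {X : Type*} [TopologicalSpace X] {g h : X → ℂ} {x : X}
    (hg : ContinuousAt g x) (hh : ContinuousAt h x) (h0 : h x = 0 → g x = 0) :
    ContinuousAt (fun y => g y * dir (h y)) x := by
  by_cases hx : h x = 0
  · have hg0 : Filter.Tendsto g (nhds x) (nhds 0) := by
      rw [← h0 hx]
      exact hg
    rw [ContinuousAt, h0 hx, zero_mul]
    refine squeeze_zero_norm (fun y => ?_) (tendsto_zero_iff_norm_tendsto_zero.1 hg0)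
    rw [norm_mul]
    exact mul_le_of_le_one_right (norm_nonneg _) (norm_dir_le _)
  · exact hg.mul (ContinuousAt.comp (continuousAt_dir hx) hh)

/-- A parametrization of the pinched torus by pairs of unit complex numbers. -/
def joint (x y : ℂ) : ℝ × ℂ × ℂ :=
  (x.re, ((1 - x.re : ℝ) : ℂ) * y, ((x.im : ℝ) : ℂ) * -Complex.I * y)

lemma continuous_joint : Continuous fun p : ℂ × ℂ => joint p.1 p.2 := by
  unfold joint
  fun_prop

lemma joint_one (y : ℂ) : joint 1 y = (1, 0, 0) := by simp [joint]

lemma re_sq_add_im_sq {x : ℂ} (hx : ‖x‖ = 1) : x.re ^ 2 + x.im ^ 2 = 1 := by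
  have := Complex.sq_norm x
  rw [hx, Complex.normSq_apply] at this
  linarith

lemma eq_one_of_re {x : ℂ} (hx : ‖x‖ = 1) (h : x.re = 1) : x = 1 := by
  have := re_sq_add_im_sq hx
  rw [h] at this
  have him : x.im = 0 := by nlinarith
  apply Complex.ext <;> simp [h, him]

lemma joint_eq_iff {x y x' y' : ℂ} (hx : ‖x‖ = 1) (hx' : ‖x'‖ = 1) (hy : ‖y‖ = 1) :
    joint x y = joint x' y' ↔ x = x' ∧ (x = 1 ∨ y = y') := by
  constructor
  · intro h
    have h1 : x.re = x'.re := congrArg Prod.fst h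
    have h2 := congrArg (fun p => p.2.1) h
    have h3 := congrArg (fun p => p.2.2) h
    simp only [joint] at h2 h3
    by_cases hc : x.re = 1
    · have e := eq_one_of_re hx hc
      exact ⟨e.trans (eq_one_of_re hx' (h1 ▸ hc)).symm, Or.inl e⟩
    · have hc' : ((1 - x.re : ℝ) : ℂ) ≠ 0 := by exact_mod_cast sub_ne_zero.2 (Ne.symm hc)
      rw [← h1] at h2
      have hyy : y = y' := mul_left_cancel₀ hc' h2
      have hy0 : y ≠ 0 := by
        rw [← norm_ne_zero_iff, hy]
        exact one_ne_zero
      rw [← hyy] at h3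
      have h4 := mul_right_cancel₀ (neg_ne_zero.2 Complex.I_ne_zero) (mul_right_cancel₀ hy0 h3)
      exact ⟨Complex.ext h1 (by exact_mod_cast h4), Or.inr hyy⟩
  · rintro ⟨rfl, rfl | rfl⟩
    · simp [joint_one]
    · rfl

/-- The pinched torus, as a subset of Euclidean space. -/
def model : Set (ℝ × ℂ × ℂ) := {p | ∃ x y : ℂ, ‖x‖ = 1 ∧ ‖y‖ = 1 ∧ joint x y = p}

lemma joint_mem_model {x y : ℂ} (hx : ‖x‖ = 1) (hy : ‖y‖ = 1) : joint x y ∈ model :=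
  ⟨x, y, hx, hy, rfl⟩

/-- The image of a pair of polynomials in the pinched torus. -/
def retr (κ : Coef) : ℝ × ℂ × ℂ := joint (dir (xi κ)) (dir κ.2.2.1)

lemma dir_xi_eq_one {κ : Coef} (hκ : xi κ ≠ 0) (h : 0 ≤ κ.2.1 ∨ κ.2.2.1 = 0) :
    dir (xi κ) = 1 := by
  have him : (xi κ).im = 0 := by
    rcases h with h | h
    · simp [xi, Real.sqrt_eq_zero_of_nonpos (neg_nonpos.2 h)]
    · simp [xi, h]
  refine dir_of_pos him (lt_of_le_of_ne ?_ fun h0 => hκ (Complex.ext h0.symm him))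
  have := Complex.normSq_nonneg κ.2.2.2
  rcases h with h | h
  · have := mul_nonneg h (Complex.normSq_nonneg κ.2.2.1)
    simp only [xi]
    linarith
  · simpa [xi, h] using this

lemma one_mem_model : ((1, 0, 0) : ℝ × ℂ × ℂ) ∈ model := ⟨1, 1, norm_one, norm_one, joint_one _⟩

lemma retr_eq_one {κ : Coef} (hκ : xi κ ≠ 0) (h : 0 ≤ κ.2.1 ∨ κ.2.2.1 = 0) :
    retr κ = (1, 0, 0) := by
  rw [retr, dir_xi_eq_one hκ h, joint_one]

lemma retr_mem_model {κ : Coef} (hκ : xi κ ≠ 0) : retr κ ∈ model := by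
  by_cases ha : κ.2.2.1 = 0
  · rw [retr_eq_one hκ (Or.inr ha)]
    exact one_mem_model
  · exact ⟨_, _, norm_dir hκ, norm_dir ha, rfl⟩

lemma continuousAt_retr {κ : Coef} (hκ : xi κ ≠ 0) : ContinuousAt retr κ := by
  have hd : ContinuousAt (fun κ => dir (xi κ)) κ :=
    ContinuousAt.comp (continuousAt_dir hκ) continuous_xi.continuousAt
  have hre := Complex.continuous_re.continuousAt.comp hd
  have him := Complex.continuous_im.continuousAt.comp hd
  have ha : ContinuousAt (fun κ : Coef => κ.2.2.1) κ := by fun_prop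
  refine hre.prodMk (ContinuousAt.prodMk ?_ ?_)
  · refine continuousAt_mul_dir (Complex.continuous_ofReal.continuousAt.comp
      (continuousAt_const.sub hre)) ha fun h => ?_
    simp [dir_xi_eq_one hκ (Or.inr h)]
  · refine continuousAt_mul_dir ((Complex.continuous_ofReal.continuousAt.comp him).mul
      continuousAt_const) ha fun h => ?_
    simp [dir_xi_eq_one hκ (Or.inr h)]

/-- The map from `ratSet 2 2` to the pinched torus. -/
def toModel : ratSet 2 2 → model :=
  Function.extend ncIn (fun κ => ⟨retr κ.1, retr_mem_model κ.2⟩) fun _ => ⟨_, one_mem_model⟩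

lemma toModel_ncIn (κ : Nonconst) : toModel (ncIn κ) = ⟨retr κ.1, retr_mem_model κ.2⟩ :=
  isOpenEmbedding_ncIn.injective.extend_apply _ _ κ

lemma toModel_constIn : toModel constIn = ⟨_, one_mem_model⟩ :=
  Function.extend_apply' _ _ _ constIn_notMem_range

lemma continuous_toModel : Continuous toModel := by
  refine continuous_iff_continuousAt.2 fun f => ?_
  rcases eq_constIn_or_eq_ncIn f with rfl | ⟨κ, rfl⟩
  · refine (continuousAt_const (y := (⟨_, one_mem_model⟩ : model))).congr ?_
    filter_upwards [nearConst_mem_nhds one_pos] with f hf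
    rcases eq_constIn_or_eq_ncIn f with rfl | ⟨κ, rfl⟩
    · exact toModel_constIn.symm
    · rw [toModel_ncIn]
      exact Subtype.ext (retr_eq_one κ.2 (Or.inl (of_ncIn_mem_nearConst one_pos hf).1.le)).symm
  · rw [← isOpenEmbedding_ncIn.continuousAt_iff]
    have : toModel ∘ ncIn = fun κ => ⟨retr κ.1, retr_mem_model κ.2⟩ := funext toModel_ncIn
    rw [this, Topology.IsInducing.subtypeVal.continuousAt_iff]
    exact ContinuousAt.comp (g := retr) (continuousAt_retr κ.2) continuous_subtype_val.continuousAt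

/-- The invariant `xi` of the pair of polynomials given by a point of the pinched torus, up to a
positive factor. -/
def twist (x : ℂ) : ℂ := ⟨1 + 2 * x.re - x.re ^ 2, 2 * √(-x.re) * x.im⟩

lemma continuous_twist : Continuous twist := by
  have h : twist = fun x : ℂ => ((1 + 2 * x.re - x.re ^ 2 : ℝ) : ℂ) +
      ((2 * √(-x.re) * x.im : ℝ) : ℂ) * Complex.I := by
    funext x
    apply Complex.ext <;> simp [twist, pow_two]
  rw [h]
  fun_prop

lemma xi_joint {x y : ℂ} (hx : ‖x‖ = 1) (hy : ‖y‖ = 1) :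
    xi (0, joint x y) = ((1 - x.re : ℝ) : ℂ) * twist x := by
  have h1 := re_sq_add_im_sq hx
  have h2 := re_sq_add_im_sq hy
  apply Complex.ext
  · simp [xi, joint, twist, Complex.normSq_apply, Complex.mul_re, Complex.mul_im]
    linear_combination (x.im ^ 2 + x.re * (1 - x.re) ^ 2) * h2 + h1
  · simp [xi, joint, twist, Complex.mul_re, Complex.mul_im]
    linear_combination (2 * √(-x.re) * (1 - x.re) * x.im) * h2

lemma twist_segment_ne_zero {x : ℂ} (hx : ‖x‖ = 1) {τ : ℝ} (h0 : 0 ≤ τ) (h1 : τ ≤ 1) :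
    ((1 - τ : ℝ) : ℂ) * twist x + (τ : ℂ) * x ≠ 0 := by
  intro h
  have hre := congrArg Complex.re h
  have him := congrArg Complex.im h
  simp [twist] at hre him
  have hn := re_sq_add_im_sq hx
  have hsq := Real.sqrt_nonneg (-x.re)
  have him : x.im * ((1 - τ) * (2 * √(-x.re)) + τ) = 0 := by linear_combination him
  rcases mul_eq_zero.1 him with hs | hs
  · have hc : (x.re - 1) * (x.re + 1) = 0 := by rw [hs] at hn; linear_combination hn
    rcases mul_eq_zero.1 hc with hc | hc
    · have hc : x.re = 1 := by linarith
      rw [hc] at hre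
      linarith
    · have hc : x.re = -1 := by linarith
      rw [hc] at hre
      linarith
  · have p1 : 0 ≤ (1 - τ) * (2 * √(-x.re)) := mul_nonneg (by linarith) (by linarith)
    have hτ : τ = 0 := by linarith
    subst hτ
    have hc : 0 ≤ x.re := by
      by_contra hneg
      have := Real.sqrt_pos.2 (by linarith : 0 < -x.re)
      linarith
    nlinarith

lemma twist_ne_zero {x : ℂ} (hx : ‖x‖ = 1) : twist x ≠ 0 := by
  simpa using twist_segment_ne_zero hx le_rfl zero_le_one

lemma model_mem_noRealRoot {p : ℝ × ℂ × ℂ} (hp : p ∈ model) : (0, p) ∈ noRealRoot := by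
  obtain ⟨x, y, hx, hy, rfl⟩ := hp
  by_cases hc : x.re = 1
  · exact mem_noRealRoot_of_pos (by simp [joint, hc])
  · refine mem_noRealRoot_of_xi_ne ?_
    rw [xi_joint hx hy]
    exact mul_ne_zero (by exact_mod_cast sub_ne_zero.2 (Ne.symm hc)) (twist_ne_zero hx)

/-- The map from the pinched torus to `ratSet 2 2`. -/
def ofModel (p : model) : ratSet 2 2 := loopIn ⟨(0, p.1), model_mem_noRealRoot p.2⟩

lemma continuous_ofModel : Continuous ofModel := by
  refine continuous_loopIn.comp (Continuous.subtype_mk ?_ _)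
  fun_prop

lemma toModel_loopIn {κ : noRealRoot} (h : xi κ.1 ≠ 0) : (toModel (loopIn κ)).1 = retr κ.1 :=
  congrArg Subtype.val (toModel_ncIn ⟨κ.1, h⟩)

lemma twist_one : dir (twist 1) = 1 := dir_of_pos (by simp [twist]) (by norm_num [twist])

lemma toModel_ofModel {x y : ℂ} (hx : ‖x‖ = 1) (hy : ‖y‖ = 1) :
    (toModel (ofModel ⟨joint x y, joint_mem_model hx hy⟩)).1 = joint (dir (twist x)) y := by
  by_cases hc : x.re = 1
  · have := eq_one_of_re hx hc
    subst this
    rw [twist_one, ofModel, loopIn_eq_constIn (by simp [joint]), toModel_constIn, joint_one]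
  · have hpos : 0 < 1 - x.re := by
      have := Complex.re_le_norm x
      rw [hx] at this
      exact sub_pos.2 (lt_of_le_of_ne this hc)
    have hxi : xi (0, joint x y) ≠ 0 := by
      rw [xi_joint hx hy]
      exact mul_ne_zero (by exact_mod_cast hpos.ne') (twist_ne_zero hx)
    rw [ofModel, toModel_loopIn hxi, retr, xi_joint hx hy, dir_mul_of_pos hpos]
    congr 1
    simp only [joint]
    rw [dir_mul_of_pos hpos, dir_of_norm_one hy]

/-! ### The deformation of `ratSet 2 2` onto the pinched torus -/

/-- The coefficients along the deformation of a loop. -/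
def deform (τ : ℝ) (κ : Coef) : Coef :=
  ((1 - τ) * κ.1, (1 - τ) * κ.2.1 + (τ + τ * (1 - τ) * |κ.2.1|) * (retr κ).1,
    ((1 - τ : ℝ) : ℂ) * κ.2.2.1 + (τ : ℂ) * (retr κ).2.1,
    ((1 - τ : ℝ) : ℂ) ^ 2 * κ.2.2.2 + (τ : ℂ) * (retr κ).2.2)

lemma deform_zero (κ : Coef) : deform 0 κ = κ := by simp [deform]

lemma deform_one (κ : Coef) : deform 1 κ = (0, retr κ) := by simp [deform]

lemma deform_of_retr_eq_one {κ : Coef} (h : retr κ = (1, 0, 0)) (τ : ℝ) :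
    deform τ κ = ((1 - τ) * κ.1, (1 - τ) * κ.2.1 + (τ + τ * (1 - τ) * |κ.2.1|),
      ((1 - τ : ℝ) : ℂ) * κ.2.2.1, ((1 - τ : ℝ) : ℂ) ^ 2 * κ.2.2.2) := by
  simp [deform, h]

lemma deform_real_aux {r α b₁ b₂ c s N τ z : ℝ} (hr : 0 < r) (hα : 0 < α) (hN : 0 < N)
    (h0 : 0 ≤ τ) (h1 : τ ≤ 1) (hcs : c ^ 2 + s ^ 2 = 1)
    (hc : N * c = b₁ ^ 2 + b₂ ^ 2 - r ^ 2 * α ^ 2) (hs : N * s = -2 * r * α * b₂)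
    (hz : z ^ 2 - (1 - τ) * r ^ 2 + (τ + τ * (1 - τ) * r ^ 2) * c = 0)
    (hre : z * ((1 - τ) * α + τ * (1 - c)) + (1 - τ) ^ 2 * b₁ = 0)
    (him : (1 - τ) ^ 2 * b₂ = τ * s) : False := by
  have hb : b₂ * (N * (1 - τ) ^ 2 + 2 * r * α * τ) = 0 := by
    linear_combination N * him + τ * hs
  have hpos : 0 < N * (1 - τ) ^ 2 + 2 * r * α * τ := by
    rcases h0.eq_or_lt with rfl | h0
    · simpa using hN
    · positivity
  have hb2 : b₂ = 0 := (mul_eq_zero.1 hb).resolve_right hpos.ne'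
  subst hb2
  have hs0 : s = 0 := by
    have : N * s = 0 := by linarith
    exact (mul_eq_zero.1 this).resolve_left hN.ne'
  subst hs0
  have hc2 : (c - 1) * (c + 1) = 0 := by linear_combination hcs
  have hα2 : 0 < α ^ 2 := by positivity
  have hr2 : 0 < r ^ 2 := by positivity
  rcases mul_eq_zero.1 hc2 with hc1 | hc1
  · obtain rfl : c = 1 := by linarith
    have hτ : 1 - τ ≠ 0 := by
      intro hτ
      rw [hτ] at hz
      nlinarith [sq_nonneg z]
    have e : z * α = -(1 - τ) * b₁ := by
      apply mul_left_cancel₀ hτ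
      linear_combination hre
    have e2 : z ^ 2 * α ^ 2 = (1 - τ) ^ 2 * b₁ ^ 2 := by
      linear_combination (z * α - (1 - τ) * b₁) * e
    have e3 : 0 < (1 - τ) ^ 2 := by positivity
    have e4 : (1 - τ) ^ 2 * (b₁ ^ 2 - r ^ 2 * α ^ 2) + τ * α ^ 2 = 0 := by
      linear_combination α ^ 2 * hz - e2
    have e5 : 0 < (1 - τ) ^ 2 * (b₁ ^ 2 - r ^ 2 * α ^ 2) := mul_pos e3 (by linarith)
    have e6 : 0 ≤ τ * α ^ 2 := by positivity
    linarith
  · obtain rfl : c = -1 := by linarith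
    have hz' : z ^ 2 = (1 - τ ^ 2) * r ^ 2 + τ := by linear_combination hz
    have hτ : 1 - τ ≠ 0 := by
      intro hτ
      obtain rfl : τ = 1 := by linarith
      have : z = 0 := by linarith
      rw [this] at hz'
      norm_num at hz'
    have hτ' : 0 < 1 - τ := lt_of_le_of_ne (by linarith) hτ.symm
    have e2 : z ^ 2 * ((1 - τ) * α + 2 * τ) ^ 2 = (1 - τ) ^ 4 * b₁ ^ 2 := by
      linear_combination (z * ((1 - τ) * α + 2 * τ) - (1 - τ) ^ 2 * b₁) * hre
    have e3 : (1 - τ) ^ 4 * b₁ ^ 2 < (1 - τ) ^ 4 * (r ^ 2 * α ^ 2) :=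
      mul_lt_mul_of_pos_left (by linarith) (by positivity)
    have e4 : (1 - τ) ^ 2 * r ^ 2 ≤ z ^ 2 := by
      rw [hz']
      nlinarith [mul_nonneg h0 hτ'.le, mul_nonneg (mul_nonneg h0 hτ'.le) hr2.le]
    have e5 : ((1 - τ) * α) ^ 2 ≤ ((1 - τ) * α + 2 * τ) ^ 2 :=
      pow_le_pow_left₀ (by positivity) (by linarith) 2
    have e6 : (1 - τ) ^ 2 * r ^ 2 * ((1 - τ) * α) ^ 2 ≤ z ^ 2 * ((1 - τ) * α + 2 * τ) ^ 2 :=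
      mul_le_mul e4 e5 (by positivity) (by positivity)
    have e7 : (1 - τ) ^ 2 * r ^ 2 * ((1 - τ) * α) ^ 2 = (1 - τ) ^ 4 * (r ^ 2 * α ^ 2) := by ring
    linarith

lemma deform_mem_noRealRoot {κ : Coef} (hκ : xi κ ≠ 0) {τ : ℝ} (h0 : 0 ≤ τ) (h1 : τ ≤ 1) :
    deform τ κ ∈ noRealRoot := by
  intro t ht
  have ht1 := congrArg Prod.fst ht
  have ht2 := congrArg Prod.snd ht
  simp only [evalCoef, Prod.fst_zero, Prod.snd_zero] at ht1 ht2
  obtain ⟨z, hz⟩ : ∃ z, z = t - (deform τ κ).1 := ⟨_, rfl⟩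
  rw [← hz] at ht1 ht2
  by_cases hβ : 0 ≤ κ.2.1
  · have hR := deform_of_retr_eq_one (retr_eq_one hκ (Or.inl hβ)) τ
    rw [hR] at ht1 ht2
    simp only [abs_of_nonneg hβ] at ht1 ht2
    have p1 : 0 ≤ (1 - τ) * κ.2.1 := mul_nonneg (by linarith) hβ
    have p2 : 0 ≤ τ * (1 - τ) * κ.2.1 := by
      rw [mul_assoc]
      exact mul_nonneg h0 p1
    have hτ : τ = 0 := by nlinarith [sq_nonneg z]
    subst hτ
    have hz0 : z = 0 := by nlinarith [sq_nonneg z]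
    subst hz0
    have hβ0 : κ.2.1 = 0 := by linarith
    have hb : κ.2.2.2 = 0 := by simpa using ht2
    apply hκ
    apply Complex.ext <;> simp [xi, hβ0, hb]
  by_cases ha : κ.2.2.1 = 0
  · have hR := deform_of_retr_eq_one (retr_eq_one hκ (Or.inr ha)) τ
    rw [hR] at ht1 ht2
    simp only [ha, mul_zero, zero_add, mul_eq_zero] at ht2
    rcases ht2 with ht2 | ht2
    · have hτ : 1 - τ = 0 := by exact_mod_cast pow_eq_zero_iff two_ne_zero |>.1 ht2
      rw [hτ] at ht1
      nlinarith [sq_nonneg z]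
    · apply hκ
      apply Complex.ext <;> simp [xi, ha, ht2]
  have hd := norm_dir ha
  have hna := norm_mul_dir κ.2.2.1
  have hnx := norm_mul_dir (xi κ)
  have hx := re_sq_add_im_sq (norm_dir hκ)
  have hN : 0 < ‖xi κ‖ := norm_pos_iff.2 hκ
  have hα : 0 < ‖κ.2.2.1‖ := norm_pos_iff.2 ha
  simp only [deform, retr, joint] at ht1 ht2
  obtain ⟨μ, β, a, b⟩ := κ
  simp only at hβ ha hd hna hα ht1 ht2
  rw [abs_of_neg (not_le.1 hβ)] at ht1
  obtain ⟨d, hdd⟩ : ∃ d, d = dir a := ⟨_, rfl⟩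
  obtain ⟨x, hxx⟩ : ∃ x, x = dir (xi (μ, β, a, b)) := ⟨_, rfl⟩
  obtain ⟨α, hαα⟩ : ∃ α, α = ‖a‖ := ⟨_, rfl⟩
  obtain ⟨N, hNN⟩ : ∃ N, N = ‖xi (μ, β, a, b)‖ := ⟨_, rfl⟩
  rw [← hdd] at hd hna ht2
  rw [← hαα] at hna hα
  rw [← hxx] at hx hnx ht1 ht2
  rw [← hNN] at hnx hN
  have hd2 := re_sq_add_im_sq hd
  have hr : 0 < √(-β) := Real.sqrt_pos.2 (by linarith)
  have hr2 : √(-β) ^ 2 = -β := Real.sq_sqrt (by linarith)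
  have hxre := congrArg Complex.re hnx
  have hxim := congrArg Complex.im hnx
  have hare := congrArg Complex.re hna
  have haim := congrArg Complex.im hna
  simp [xi, Complex.normSq_apply] at hxre hxim hare haim
  have hre := congrArg Complex.re ht2
  have him := congrArg Complex.im ht2
  simp [← hna, pow_two] at hre him
  refine deform_real_aux (r := √(-β)) (α := α) (b₁ := b.re * d.re + b.im * d.im)
    (b₂ := b.im * d.re - b.re * d.im) (c := x.re) (s := x.im) (N := N) (τ := τ) (z := z)
    hr hα hN h0 h1 hx ?_ ?_ ?_ ?_ ?_
  · rw [hxre, hr2, ← hare, ← haim]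
    linear_combination (-(b.re ^ 2 + b.im ^ 2) + β * α ^ 2) * hd2
  · rw [hxim, ← hare, ← haim]
    ring
  · rw [hr2]
    linear_combination ht1
  · linear_combination d.re * hre + d.im * him -
      (z * ((1 - τ) * α + τ * (1 - x.re))) * hd2
  · linear_combination d.re * him - d.im * hre + τ * x.im * hd2

lemma continuousAt_deform {κ : Coef} (hκ : xi κ ≠ 0) (τ : ℝ) :
    ContinuousAt (fun p : ℝ × Coef => deform p.1 p.2) (τ, κ) := by
  have h : ContinuousAt (fun p : ℝ × Coef => retr p.2) (τ, κ) :=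
    ContinuousAt.comp (f := fun p : ℝ × Coef => p.2) (continuousAt_retr hκ) continuousAt_snd
  have hc : Continuous fun q : (ℝ × Coef) × (ℝ × ℂ × ℂ) =>
      (((1 - q.1.1) * q.1.2.1, (1 - q.1.1) * q.1.2.2.1 +
        (q.1.1 + q.1.1 * (1 - q.1.1) * |q.1.2.2.1|) * q.2.1,
        ((1 - q.1.1 : ℝ) : ℂ) * q.1.2.2.2.1 + (q.1.1 : ℂ) * q.2.2.1,
        ((1 - q.1.1 : ℝ) : ℂ) ^ 2 * q.1.2.2.2.2 + (q.1.1 : ℂ) * q.2.2.2) : Coef) := by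
    fun_prop
  exact ContinuousAt.comp (f := fun p : ℝ × Coef => (p, retr p.2)) hc.continuousAt
    (continuousAt_id.prodMk h)

lemma deform_norm_lt {κ : Coef} {ε : ℝ} (hε : 0 < ε) (hβ : 0 < κ.2.1) (hκ : xi κ ≠ 0)
    (h : ∀ t : ℝ, ‖(t : ℂ) * κ.2.2.1 + κ.2.2.2‖ ≤ ε / 3 * (t ^ 2 + κ.2.1)) {τ : ℝ} (h0 : 0 ≤ τ)
    (h1 : τ ≤ 1) (t : ℝ) :
    ‖(evalCoef (deform τ κ) t).2‖ < ε * (evalCoef (deform τ κ) t).1 := by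
  rw [deform_of_retr_eq_one (retr_eq_one hκ (Or.inl hβ.le)), abs_of_pos hβ]
  simp only [evalCoef]
  obtain ⟨z, hz⟩ : ∃ z, z = t - (1 - τ) * κ.1 := ⟨_, rfl⟩
  rw [← hz]
  have hb : ‖κ.2.2.2‖ ≤ ε / 3 * κ.2.1 := by simpa using h 0
  have hv := h z
  have e : (z : ℂ) * (((1 - τ : ℝ) : ℂ) * κ.2.2.1) + ((1 - τ : ℝ) : ℂ) ^ 2 * κ.2.2.2 =
      ((1 - τ : ℝ) : ℂ) * ((z : ℂ) * κ.2.2.1 + κ.2.2.2) -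
        ((1 - τ : ℝ) : ℂ) * (τ : ℂ) * κ.2.2.2 := by
    push_cast
    ring
  have hle : ‖(z : ℂ) * (((1 - τ : ℝ) : ℂ) * κ.2.2.1) + ((1 - τ : ℝ) : ℂ) ^ 2 * κ.2.2.2‖ ≤
      (1 - τ) * (ε / 3 * (z ^ 2 + κ.2.1)) + (1 - τ) * τ * (ε / 3 * κ.2.1) := by
    rw [e]
    refine (norm_sub_le _ _).trans (add_le_add ?_ ?_)
    · rw [norm_mul, Complex.norm_real, Real.norm_of_nonneg (by linarith)]
      exact mul_le_mul_of_nonneg_left hv (by linarith)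
    · rw [norm_mul, norm_mul, Complex.norm_real, Complex.norm_real, Real.norm_of_nonneg h0,
        Real.norm_of_nonneg (by linarith)]
      exact mul_le_mul_of_nonneg_left hb (mul_nonneg (by linarith) h0)
  refine hle.trans_lt ?_
  have hτ : 0 ≤ 1 - τ := by linarith
  have hp : 0 < (1 - τ) * κ.2.1 + τ := by
    rcases h0.eq_or_lt with rfl | h0
    · simpa using hβ
    · positivity
  have q1 : 0 ≤ τ * z ^ 2 := by positivity
  have q2 : 0 ≤ τ * (1 - τ) * κ.2.1 := by positivity
  have key : (1 - τ) * (z ^ 2 + κ.2.1) + (1 - τ) * τ * κ.2.1 <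
      3 * (z ^ 2 + ((1 - τ) * κ.2.1 + (τ + τ * (1 - τ) * κ.2.1))) := by
    nlinarith [sq_nonneg z]
  have := mul_lt_mul_of_pos_left key (by positivity : 0 < ε / 3)
  linarith

open unitInterval in
/-- The deformation of a loop. -/
def deformLoop (τ : I) : ratSet 2 2 → ratSet 2 2 :=
  Function.extend ncIn
    (fun κ => loopIn ⟨deform τ κ.1, deform_mem_noRealRoot κ.2 τ.2.1 τ.2.2⟩) fun _ => constIn

lemma deformLoop_ncIn (τ : unitInterval) (κ : Nonconst) : deformLoop τ (ncIn κ) =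
    loopIn ⟨deform τ κ.1, deform_mem_noRealRoot κ.2 τ.2.1 τ.2.2⟩ :=
  isOpenEmbedding_ncIn.injective.extend_apply _ _ κ

lemma deformLoop_constIn (τ : unitInterval) : deformLoop τ constIn = constIn :=
  Function.extend_apply' _ _ _ constIn_notMem_range

lemma continuous_deformLoop :
    Continuous fun p : unitInterval × ratSet 2 2 => deformLoop p.1 p.2 := by
  refine Continuous.subtype_mk (f := fun p : unitInterval × ratSet 2 2 => (deformLoop p.1 p.2).1)
    ?_ _
  refine Continuous.subtype_mk
    (f := fun p : unitInterval × ratSet 2 2 => (deformLoop p.1 p.2).1.1) ?_ _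
  refine ContinuousMap.continuous_of_continuous_uncurry _ ?_
  refine continuous_iff_continuousAt.2 ?_
  rintro ⟨⟨τ, f⟩, t⟩
  rcases eq_constIn_or_eq_ncIn f with rfl | ⟨κ, rfl⟩
  · intro U hU
    change U ∈ nhds ((deformLoop τ constIn).1.1 t) at hU
    rw [deformLoop_constIn] at hU
    change U ∈ nhds (basept 2) at hU
    obtain ⟨ε, hε, hsub⟩ := exists_cone_subset hU
    have hN : ∀ᶠ p : (unitInterval × ratSet 2 2) × OnePoint ℝ in nhds ((τ, constIn), t),
        p.1.2 ∈ nearConst (ε / 3) :=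
      (continuous_snd.comp continuous_fst).continuousAt.eventually
        (nearConst_mem_nhds (by positivity))
    refine Filter.mem_map.2 ?_
    filter_upwards [hN]
    rintro ⟨⟨σ, f⟩, s⟩ hf
    change (deformLoop σ f).1.1 s ∈ U
    induction s using OnePoint.rec with
    | infty =>
      rw [(deformLoop σ f).1.2]
      exact mem_of_mem_nhds hU
    | coe s =>
      rcases eq_constIn_or_eq_ncIn f with rfl | ⟨κ, rfl⟩
      · rw [deformLoop_constIn]
        exact mem_of_mem_nhds hU
      · obtain ⟨hβ, hv⟩ := of_ncIn_mem_nearConst (by positivity) hf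
        rw [deformLoop_ncIn]
        change (loopOf _).1 s ∈ U
        rw [loopOf_coe]
        exact hsub _ (deform_norm_lt hε hβ κ.2 hv σ.2.1 σ.2.2 s)
  · have he : Topology.IsOpenEmbedding
        (Prod.map (Prod.map (id : unitInterval → unitInterval) ncIn)
          (id : OnePoint ℝ → OnePoint ℝ)) :=
      (Topology.IsOpenEmbedding.id.prodMap isOpenEmbedding_ncIn).prodMap
        Topology.IsOpenEmbedding.id
    refine (he.continuousAt_iff (x := ((τ, κ), t))).1 ?_
    have : ContinuousAt (fun p : (unitInterval × Nonconst) × OnePoint ℝ =>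
        pt (normEval (deform p.1.1 p.1.2.1) p.2)) ((τ, κ), t) := by
      refine ContinuousAt.comp
        (f := fun p : (unitInterval × Nonconst) × OnePoint ℝ =>
          normEval (deform p.1.1 p.1.2.1) p.2)
        (continuousAt_pt (normEval_ne_zero (deform_mem_noRealRoot κ.2 τ.2.1 τ.2.2) t)) ?_
      refine ContinuousAt.comp (g := fun p : Coef × OnePoint ℝ => normEval p.1 p.2)
        (f := fun p : (unitInterval × Nonconst) × OnePoint ℝ =>
          (deform p.1.1 p.1.2.1, p.2))
        continuous_normEval.continuousAt (ContinuousAt.prodMk ?_ continuousAt_snd)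
      exact ContinuousAt.comp (g := fun p : ℝ × Coef => deform p.1 p.2)
        (f := fun p : (unitInterval × Nonconst) × OnePoint ℝ => ((p.1.1 : ℝ), p.1.2.1))
        (continuousAt_deform κ.2 τ) (by fun_prop)
    convert this using 1
    funext p
    change (deformLoop p.1.1 (ncIn p.1.2)).1.1 p.2 = _
    rw [deformLoop_ncIn]
    rfl

lemma deformLoop_zero (f : ratSet 2 2) : deformLoop 0 f = f := by
  rcases eq_constIn_or_eq_ncIn f with rfl | ⟨κ, rfl⟩
  · exact deformLoop_constIn 0
  · rw [deformLoop_ncIn, ncIn]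
    congr 2
    exact deform_zero κ.1

lemma deformLoop_one (f : ratSet 2 2) : deformLoop 1 f = ofModel (toModel f) := by
  rcases eq_constIn_or_eq_ncIn f with rfl | ⟨κ, rfl⟩
  · rw [deformLoop_constIn, toModel_constIn, ofModel, loopIn_eq_constIn rfl]
  · rw [deformLoop_ncIn, toModel_ncIn, ofModel]
    congr 2
    exact deform_one κ.1

/-! ### The homotopy equivalence -/

/-- The self-homotopy of the circle from `dir ∘ twist` to the identity. -/
def circleHomotopy (τ : ℝ) (x : ℂ) : ℂ := dir (((1 - τ : ℝ) : ℂ) * twist x + (τ : ℂ) * x)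

lemma norm_circleHomotopy {x : ℂ} (hx : ‖x‖ = 1) {τ : ℝ} (h0 : 0 ≤ τ) (h1 : τ ≤ 1) :
    ‖circleHomotopy τ x‖ = 1 := norm_dir (twist_segment_ne_zero hx h0 h1)

lemma circleHomotopy_one {τ : ℝ} (h1 : τ ≤ 1) : circleHomotopy τ 1 = 1 := by
  refine dir_of_pos (by simp [twist]) ?_
  simp [twist]
  linarith

/-- The parametrization of the pinched torus by the torus. -/
def jointMap : C(Metric.sphere (0 : ℂ) 1 × Metric.sphere (0 : ℂ) 1, model) where
  toFun p := ⟨joint p.1 p.2, joint_mem_model (norm_eq_of_mem_sphere p.1) (norm_eq_of_mem_sphere p.2)⟩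
  continuous_toFun := by
    refine Continuous.subtype_mk (continuous_joint.comp (Continuous.prodMk ?_ ?_)) _
    · fun_prop
    · fun_prop

lemma surjective_jointMap : Function.Surjective jointMap := by
  rintro ⟨p, x, y, hx, hy, rfl⟩
  exact ⟨(⟨x, by simpa using hx⟩, ⟨y, by simpa using hy⟩), rfl⟩

lemma jointMap_eq_iff {p q : Metric.sphere (0 : ℂ) 1 × Metric.sphere (0 : ℂ) 1} :
    jointMap p = jointMap q ↔ p.1 = q.1 ∧ (p.1.1 = 1 ∨ p.2 = q.2) := by
  rw [Subtype.ext_iff, Subtype.ext_iff, Subtype.ext_iff]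
  exact joint_eq_iff (norm_eq_of_mem_sphere p.1) (norm_eq_of_mem_sphere q.1)
    (norm_eq_of_mem_sphere p.2)

/-- `jointMap` times the identity of the unit interval. -/
def jointMapI : C(unitInterval × (Metric.sphere (0 : ℂ) 1 × Metric.sphere (0 : ℂ) 1),
    unitInterval × model) := (ContinuousMap.id _).prodMap jointMap

lemma isQuotientMap_jointMapI : Topology.IsQuotientMap jointMapI :=
  jointMapI.continuous.isClosedMap.isQuotientMap jointMapI.continuous
    (Function.surjective_id.prodMap surjective_jointMap)

/-- The homotopy of the circle times the identity, as a map to the pinched torus. -/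
def twistMap : C(unitInterval × (Metric.sphere (0 : ℂ) 1 × Metric.sphere (0 : ℂ) 1), model) where
  toFun p := ⟨joint (circleHomotopy p.1 p.2.1) p.2.2, joint_mem_model
    (norm_circleHomotopy (norm_eq_of_mem_sphere p.2.1) p.1.2.1 p.1.2.2)
    (norm_eq_of_mem_sphere p.2.2)⟩
  continuous_toFun := by
    refine Continuous.subtype_mk (continuous_joint.comp (Continuous.prodMk ?_ ?_)) _
    · refine continuous_iff_continuousAt.2 fun p => ?_
      refine ContinuousAt.comp (g := dir) (continuousAt_dir (twist_segment_ne_zero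
        (norm_eq_of_mem_sphere p.2.1) p.1.2.1 p.1.2.2)) (Continuous.continuousAt ?_)
      have := continuous_twist
      fun_prop
    · fun_prop

lemma factorsThrough_twistMap : Function.FactorsThrough twistMap jointMapI := by
  rintro ⟨τ, p⟩ ⟨σ, q⟩ h
  have hτ : τ = σ := congrArg Prod.fst h
  have hp : jointMap p = jointMap q := congrArg Prod.snd h
  subst hτ
  obtain ⟨h1, h2⟩ := jointMap_eq_iff.1 hp
  refine Subtype.ext ?_
  change joint (circleHomotopy τ p.1) p.2 = joint (circleHomotopy τ q.1) q.2
  rw [← h1]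
  rcases h2 with h2 | h2
  · rw [h2, circleHomotopy_one τ.2.2, joint_one, joint_one]
  · rw [h2]

/-- The homotopy from `toModel ∘ ofModel` to the identity. -/
def modelHomotopy : C(unitInterval × model, model) :=
  isQuotientMap_jointMapI.lift twistMap factorsThrough_twistMap

lemma modelHomotopy_jointMap (τ : unitInterval)
    (p : Metric.sphere (0 : ℂ) 1 × Metric.sphere (0 : ℂ) 1) :
    (modelHomotopy (τ, jointMap p)).1 = joint (circleHomotopy τ p.1) p.2 :=
  congrArg Subtype.val (DFunLike.congr_fun
    (isQuotientMap_jointMapI.lift_comp twistMap factorsThrough_twistMap) (τ, p))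

/-- `ratSet 2 2` is homotopy equivalent to the pinched torus. -/
def homotopyEquivModel : ContinuousMap.HomotopyEquiv (ratSet 2 2) model where
  toFun := ⟨toModel, continuous_toModel⟩
  invFun := ⟨ofModel, continuous_ofModel⟩
  left_inv := ⟨ContinuousMap.Homotopy.symm
    { toFun := fun p => deformLoop p.1 p.2
      continuous_toFun := continuous_deformLoop
      map_zero_left := deformLoop_zero
      map_one_left := deformLoop_one }⟩
  right_inv := ⟨
    { toContinuousMap := modelHomotopy
      map_zero_left := fun p => by
        obtain ⟨p, rfl⟩ := surjective_jointMap p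
        refine Subtype.ext ((modelHomotopy_jointMap 0 p).trans ?_)
        refine Eq.trans ?_ (toModel_ofModel (norm_eq_of_mem_sphere p.1)
          (norm_eq_of_mem_sphere p.2)).symm
        simp [circleHomotopy]
      map_one_left := fun p => by
        obtain ⟨p, rfl⟩ := surjective_jointMap p
        refine Subtype.ext ((modelHomotopy_jointMap 1 p).trans ?_)
        simp [circleHomotopy, jointMap, dir_of_norm_one] }⟩

/-- The rotation of the circle taking `x₀` to `1`. -/
def rotate (x₀ x : Metric.sphere (0 : ℂ) 1) : Metric.sphere (0 : ℂ) 1 :=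
  ⟨x.1 / x₀.1, by simp⟩

lemma continuous_rotate (x₀ : Metric.sphere (0 : ℂ) 1) : Continuous (rotate x₀) := by
  refine Continuous.subtype_mk ?_ _
  fun_prop

lemma rotate_injective (x₀ : Metric.sphere (0 : ℂ) 1) : Function.Injective (rotate x₀) := by
  intro x y h
  have h0 : x₀.1 ≠ 0 := ne_zero_of_mem_unit_sphere x₀
  exact Subtype.ext ((div_left_inj' h0).1 (congrArg Subtype.val h))

lemma rotate_eq_one_iff {x₀ x : Metric.sphere (0 : ℂ) 1} : (rotate x₀ x).1 = 1 ↔ x = x₀ := by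
  have h0 : x₀.1 ≠ 0 := ne_zero_of_mem_unit_sphere x₀
  rw [Subtype.ext_iff]
  exact div_eq_one_iff_eq h0

lemma rotate_surjective (x₀ : Metric.sphere (0 : ℂ) 1) : Function.Surjective (rotate x₀) := by
  intro y
  have h0 : x₀.1 ≠ 0 := ne_zero_of_mem_unit_sphere x₀
  exact ⟨⟨y.1 * x₀.1, by simp⟩, Subtype.ext (mul_div_cancel_right₀ _ h0)⟩

/-- The relation on the torus collapsing a meridian. -/
abbrev collapse (x₀ : Metric.sphere (0 : ℂ) 1)
    (a b : Metric.sphere (0 : ℂ) 1 × Metric.sphere (0 : ℂ) 1) : Prop := a.1 = x₀ ∧ b.1 = x₀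

/-- The map from the collapsed torus to its model. -/
def quotToModel (x₀ : Metric.sphere (0 : ℂ) 1) : Quot (collapse x₀) → model :=
  Quot.lift (fun p => jointMap (rotate x₀ p.1, p.2)) fun a b h =>
    jointMap_eq_iff.2 ⟨by rw [h.1, h.2], Or.inl (rotate_eq_one_iff.2 h.1)⟩

lemma bijective_quotToModel (x₀ : Metric.sphere (0 : ℂ) 1) :
    Function.Bijective (quotToModel x₀) := by
  constructor
  · rintro ⟨x, y⟩ ⟨x', y'⟩ h
    obtain ⟨h1, h2⟩ := jointMap_eq_iff.1 h
    obtain rfl : x = x' := rotate_injective x₀ h1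
    rcases h2 with h2 | h2
    · have := rotate_eq_one_iff.1 h2
      exact Quot.sound ⟨this, this⟩
    · obtain rfl : y = y' := h2
      rfl
  · intro p
    obtain ⟨⟨x, y⟩, rfl⟩ := surjective_jointMap p
    obtain ⟨x, rfl⟩ := rotate_surjective x₀ x
    exact ⟨Quot.mk _ (x, y), rfl⟩

lemma continuous_quotToModel (x₀ : Metric.sphere (0 : ℂ) 1) : Continuous (quotToModel x₀) := by
  refine continuous_quot_lift _ (jointMap.continuous.comp ?_)
  exact ((continuous_rotate x₀).comp continuous_fst).prodMk continuous_snd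

/-- The collapsed torus is homeomorphic to its model. -/
def quotHomeomorph (x₀ : Metric.sphere (0 : ℂ) 1) : Quot (collapse x₀) ≃ₜ model :=
  Continuous.homeoOfEquivCompactToT2 (f := Equiv.ofBijective _ (bijective_quotToModel x₀))
    (continuous_quotToModel x₀)

/-- The space `rat(2,2)` is homotopy equivalent to the quotient of the torus `S¹ × S¹`
obtained by collapsing the meridian `{x₀} × S¹` to a point. -/
theorem ratSet_two_two_homotopyEquiv_pinched_torus (x₀ : ↥(Metric.sphere (0 : ℂ) 1)) :
    Nonempty (ContinuousMap.HomotopyEquiv ↥(ratSet 2 2)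
      (Quot (fun a b : ↥(Metric.sphere (0 : ℂ) 1) × ↥(Metric.sphere (0 : ℂ) 1) =>
        a.1 = x₀ ∧ b.1 = x₀))) := by
  exact ⟨homotopyEquivModel.trans (quotHomeomorph x₀).symm.toHomotopyEquiv⟩

end
end

section
/- For all n ≥ 2 and m ≥ 1, the set difference rat(n,m) ∖ rat(n−2,m) equals RRat(n,m). -/
open OnePoint Projectivization

noncomputable section

open Filter Topology Polynomial

/-- The `(i, k)` entry of the orthogonal projection onto the line `ℓ`. -/
def projEntry {m : ℕ} (i k : Fin (m + 1)) (l : RP m) : ℝ :=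
  l.rep i * l.rep k / ∑ j, l.rep j ^ 2

lemma sum_sq_pos {ι : Type*} [Fintype ι] {v : ι → ℝ} (hv : v ≠ 0) : 0 < ∑ j, v j ^ 2 := by
  obtain ⟨j, hj⟩ := Function.ne_iff.1 hv
  exact Finset.sum_pos' (fun _ _ => sq_nonneg _) ⟨j, Finset.mem_univ _, by
    have : v j ≠ 0 := hj
    positivity⟩

lemma projEntry_mk {m : ℕ} (i k : Fin (m + 1)) (v : Fin (m + 1) → ℝ) (hv : v ≠ 0) :
    projEntry i k (Projectivization.mk ℝ v hv) = v i * v k / ∑ j, v j ^ 2 := by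
  obtain ⟨a, ha⟩ := Projectivization.exists_smul_eq_mk_rep ℝ v hv
  have hN := (sum_sq_pos hv).ne'
  have ha0 : (a : ℝ) ≠ 0 := a.ne_zero
  have hr (j) : (Projectivization.mk ℝ v hv).rep j = a * v j := by
    rw [← ha]; rfl
  simp only [projEntry, hr, mul_pow, ← Finset.mul_sum]
  field_simp

lemma isQuotientMap_mk' (m : ℕ) :
    Topology.IsQuotientMap (Projectivization.mk' ℝ : {v : Fin (m + 1) → ℝ // v ≠ 0} → RP m) :=
  isQuotientMap_quot_mk

lemma continuous_projEntry {m : ℕ} (i k : Fin (m + 1)) : Continuous (projEntry i k) := by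
  rw [(isQuotientMap_mk' m).continuous_iff]
  have : projEntry i k ∘ Projectivization.mk' ℝ =
      fun v : {v : Fin (m + 1) → ℝ // v ≠ 0} => v.1 i * v.1 k / ∑ j, v.1 j ^ 2 := by
    funext v
    exact projEntry_mk i k v.1 v.2
  rw [this]
  have hc (i) : Continuous fun v : {v : Fin (m + 1) → ℝ // v ≠ 0} => v.1 i :=
    (continuous_apply i).comp continuous_subtype_val
  exact ((hc i).mul (hc k)).div (continuous_finsetSum _ fun j _ => (hc j).pow 2)
    fun v => (sum_sq_pos v.2).ne'

lemma eq_mk_iff {m : ℕ} (l : RP m) (v : Fin (m + 1) → ℝ) (hv : v ≠ 0) :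
    l = Projectivization.mk ℝ v hv ↔
      ∀ i j k, projEntry i k l * v j = projEntry j k l * v i := by
  constructor
  · rintro rfl i j k
    simp only [projEntry_mk]
    ring
  · intro h
    induction l using Projectivization.ind with
    | h w hw =>
      obtain ⟨k, hk⟩ := Function.ne_iff.1 hw
      have hk : w k ≠ 0 := hk
      have hN := (sum_sq_pos hw).ne'
      symm
      rw [Projectivization.mk_eq_mk_iff']
      refine ⟨v k / w k, funext fun i => ?_⟩
      have := h i k k
      simp only [projEntry_mk] at this
      simp only [Pi.smul_apply, smul_eq_mul]
      field_simp at this ⊢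
      linarith

/-- A tuple of real polynomials is unimodular when it generates the unit ideal. -/
def Unimodular {ι : Type*} [Fintype ι] (p : ι → ℝ[X]) : Prop := ∃ a : ι → ℝ[X], ∑ i, a i * p i = 1

lemma Unimodular.exists_aeval_ne_zero {ι : Type*} [Fintype ι] {p : ι → ℝ[X]} (h : Unimodular p)
    {A : Type*} [CommRing A] [Nontrivial A] [Algebra ℝ A] (z : A) : ∃ i, aeval z (p i) ≠ 0 := by
  obtain ⟨a, ha⟩ := h
  by_contra! h0
  simpa [h0] using congrArg (aeval z) ha

lemma exists_eq_mul_unimodular {ι : Type*} [Fintype ι] {p : ι → ℝ[X]} (hp : p ≠ 0) :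
    ∃ (h : ℝ[X]) (q : ι → ℝ[X]), h ≠ 0 ∧ (∀ i, p i = h * q i) ∧ Unimodular q := by
  set I := Ideal.span (Set.range p)
  obtain ⟨h, hI⟩ := (IsPrincipalIdealRing.principal I).principal
  replace hI : I = Ideal.span {h} := hI
  have hmem (i) : h ∣ p i := by
    rw [← Ideal.mem_span_singleton, ← hI]
    exact Ideal.subset_span ⟨i, rfl⟩
  choose q hq using hmem
  have h0 : h ≠ 0 := by
    rintro rfl
    exact hp (funext fun i => by simp [hq i])
  obtain ⟨a, ha⟩ := Ideal.mem_span_range_iff_exists_fun.1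
    (show h ∈ I from hI ▸ Ideal.mem_span_singleton_self h)
  refine ⟨h, q, h0, hq, a, mul_left_cancel₀ h0 ?_⟩
  rw [mul_one, Finset.mul_sum]
  refine Eq.trans (Finset.sum_congr rfl fun i _ => ?_) ha
  rw [hq i]
  ring

lemma unimodular_of_aeval_ne_zero {ι : Type*} [Fintype ι] {p : ι → ℝ[X]}
    (hp : ∀ z : ℂ, ∃ i, aeval z (p i) ≠ 0) : Unimodular p := by
  have hp0 : p ≠ 0 := by
    rintro rfl
    obtain ⟨i, hi⟩ := hp 0
    simp at hi
  obtain ⟨h, q, h0, hq, a, ha⟩ := exists_eq_mul_unimodular hp0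
  have hdeg : h.degree = 0 := by
    by_contra hd
    obtain ⟨z, hz⟩ := IsAlgClosed.exists_aeval_eq_zero ℂ h hd
    obtain ⟨i, hi⟩ := hp z
    simp [hq, hz] at hi
  obtain ⟨u, hu⟩ := isUnit_iff_degree_eq_zero.2 hdeg
  refine ⟨fun i => (↑u⁻¹ : ℝ[X]) * a i, ?_⟩
  rw [← ha]
  refine Finset.sum_congr rfl fun i _ => ?_
  rw [hq, ← hu]
  calc (↑u⁻¹ : ℝ[X]) * a i * (u * q i) = (↑u⁻¹ * u : ℝ[X]) * (a i * q i) := by ring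
    _ = _ := by simp

lemma Unimodular.dvd {ι : Type*} [Fintype ι] {p q : ι → ℝ[X]} (hq : Unimodular q)
    (h : ∀ i j, p i * q j = p j * q i) (i : ι) : q i ∣ p i := by
  obtain ⟨a, ha⟩ := hq
  refine ⟨∑ j, a j * p j, ?_⟩
  rw [← mul_one (p i), ← ha, Finset.mul_sum, Finset.mul_sum]
  refine Finset.sum_congr rfl fun j _ => ?_
  linear_combination a j * h i j

lemma eq_of_mem_RRat {n d m : ℕ} {f : OmegaRP m} (hn : f ∈ RRat n m) (hd : f ∈ RRat d m) :
    n = d := by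
  obtain ⟨p, hpm, hpd, hpz, hp⟩ := hn
  obtain ⟨q, hqm, hqd, hqz, hq⟩ := hd
  have key (i j) : p i * q j = p j * q i := by
    refine Polynomial.funext fun x => ?_
    obtain ⟨hx, hfx⟩ := hp x
    obtain ⟨hx', hfx'⟩ := hq x
    rw [hfx] at hfx'
    obtain ⟨a, ha⟩ := (Projectivization.mk_eq_mk_iff' ..).1 hfx'
    have ha (i) : (p i).eval x = a * (q i).eval x := (congrFun ha i).symm
    simp only [eval_mul, ha]
    ring
  have h1 := natDegree_le_of_dvd ((unimodular_of_aeval_ne_zero hqz).dvd key 0) (hpm 0).ne_zero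
  have h2 := natDegree_le_of_dvd
    ((unimodular_of_aeval_ne_zero hpz).dvd (fun i j => by linear_combination key j i) 0)
    (hqm 0).ne_zero
  rw [hpd, hqd] at h1 h2
  omega

lemma tendsto_eval_div_pow {p : ℝ[X]} {d : ℕ} (hp : p.natDegree ≤ d) :
    Tendsto (fun x => p.eval x / x ^ d) atTop (𝓝 (p.coeff d)) := by
  have hX (x : ℝ) : x ^ d = (X ^ d : ℝ[X]).eval x := by simp
  simp only [hX]
  rcases (degree_le_of_natDegree_le hp).lt_or_eq with h | h
  · rw [coeff_eq_zero_of_degree_lt h]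
    exact div_tendsto_atTop_zero_of_degree_lt _ _ (by simpa using h)
  · have := div_tendsto_atTop_leadingCoeff_div_of_degree_eq p (X ^ d) (by simpa using h)
    simpa [leadingCoeff, natDegree_eq_of_degree_eq_some h] using this

lemma even_natDegree_of_eval_ne_zero {p : ℝ[X]} (hp : ∀ x, p.eval x ≠ 0) : Even p.natDegree := by
  by_contra hodd
  rw [Nat.not_even_iff_odd] at hodd
  wlog hl : 0 < p.leadingCoeff generalizing p
  · have hl0 : p.leadingCoeff ≠ 0 := by
      rw [Ne, leadingCoeff_eq_zero]
      rintro rfl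
      simp at hp
    refine this (p := -p) (by simpa using hp) (by simpa using hodd) ?_
    rw [leadingCoeff_neg]
    rcases lt_or_gt_of_ne hl0 with h | h
    · linarith
    · exact absurd h hl
  have hdeg : 0 < p.degree := natDegree_pos_iff_degree_pos.1 hodd.pos
  have h1 := p.tendsto_atTop_of_leadingCoeff_nonneg hdeg hl.le
  have hcd : (p.comp (-X)).natDegree = p.natDegree := by simp [natDegree_comp]
  have hcl : (p.comp (-X)).leadingCoeff = -p.leadingCoeff := by
    rw [leadingCoeff_comp (by simp)]
    simp [hodd.neg_one_pow]
  have h2 := (p.comp (-X)).tendsto_atBot_of_leadingCoeff_nonpos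
    (natDegree_pos_iff_degree_pos.1 (hcd ▸ hodd.pos)) (by rw [hcl]; linarith)
  obtain ⟨a, ha⟩ := (h1.eventually_gt_atTop 0).exists
  obtain ⟨b, hb⟩ := (h2.eventually_lt_atBot 0).exists
  rw [eval_comp, eval_neg, eval_X] at hb
  obtain ⟨x, hx⟩ := mem_range_of_exists_le_of_exists_ge p.continuous ⟨-b, hb.le⟩ ⟨a, ha.le⟩
  exact hp x hx

lemma natDegree_sum_mul_monic {ι : Type*} [Fintype ι] [Nonempty ι] {p q : ι → ℝ[X]} {n d : ℕ}
    (hp : ∀ i, (p i).Monic) (hpn : ∀ i, (p i).natDegree = n)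
    (hq : ∀ i, (q i).Monic) (hqd : ∀ i, (q i).natDegree = d) :
    (∑ i, p i * q i).natDegree = n + d := by
  have hi (i) : (p i * q i).natDegree = n + d := by
    rw [(hp i).natDegree_mul (hq i), hpn, hqd]
  refine natDegree_eq_of_le_of_coeff_ne_zero
    (natDegree_sum_le_of_forall_le _ _ fun i _ => (hi i).le) ?_
  have hc (i) : (p i * q i).coeff (n + d) = 1 := by
    rw [← hi i]
    exact ((hp i).mul (hq i)).coeff_natDegree
  simp [finsetSum_coeff, hc, Fintype.card_ne_zero]

lemma even_add_of_mem_closure_RRat {n d m : ℕ} {f : OmegaRP m} (hn : f ∈ closure (RRat n m))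
    (hd : f ∈ RRat d m) : Even (n + d) := by
  let Ψ : OmegaRP m → C(OnePoint ℝ, ℝ) := fun g =>
    ⟨fun x => ∑ i, ∑ k, projEntry i k (f.1 x) * projEntry i k (g.1 x),
      continuous_finsetSum _ fun i _ => continuous_finsetSum _ fun k _ =>
        ((continuous_projEntry i k).comp f.1.continuous).mul
        ((continuous_projEntry i k).comp g.1.continuous)⟩
  have hΨ : Continuous Ψ := by
    refine ContinuousMap.continuous_of_continuous_uncurry _ ?_
    have h1 : Continuous fun y : OmegaRP m × OnePoint ℝ => y.1.1 y.2 := by fun_prop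
    have h2 : Continuous fun y : OmegaRP m × OnePoint ℝ => f.1 y.2 := by fun_prop
    change Continuous fun y : OmegaRP m × OnePoint ℝ =>
      ∑ i, ∑ k, projEntry i k (f.1 y.2) * projEntry i k (y.1.1 y.2)
    exact continuous_finsetSum _ fun i _ => continuous_finsetSum _ fun k _ =>
      ((continuous_projEntry i k).comp h2).mul ((continuous_projEntry i k).comp h1)
  have hopen : IsOpen {g | Set.MapsTo (Ψ g) Set.univ (Set.Ioi 0)} :=
    (ContinuousMap.isOpen_setOfPred_mapsTo isCompact_univ isOpen_Ioi).preimage hΨ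
  have hf : f ∈ {g | Set.MapsTo (Ψ g) Set.univ (Set.Ioi 0)} := by
    intro x _
    change 0 < ∑ i, ∑ k, projEntry i k (f.1 x) * projEntry i k (f.1 x)
    generalize f.1 x = l
    induction l using Projectivization.ind with
    | h w hw =>
      have hN := sum_sq_pos hw
      have : ∑ i, ∑ k, projEntry i k (Projectivization.mk ℝ w hw) *
          projEntry i k (Projectivization.mk ℝ w hw) = 1 := by
        calc _ = ((∑ i, w i ^ 2) * ∑ i, w i ^ 2) / (∑ i, w i ^ 2) ^ 2 := by
              simp only [projEntry_mk, Finset.sum_mul_sum, Finset.sum_div]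
              refine Finset.sum_congr rfl fun i _ => Finset.sum_congr rfl fun k _ => ?_
              ring
          _ = 1 := by field_simp
      rw [this]
      exact one_pos
  obtain ⟨g, hg, p, hpm, hpd, -, hp⟩ := mem_closure_iff.1 hn _ hopen hf
  obtain ⟨q, hqm, hqd, -, hq⟩ := hd
  rw [← natDegree_sum_mul_monic hpm hpd hqm hqd]
  refine even_natDegree_of_eval_ne_zero fun x hx => ?_
  have hpos : 0 < ∑ i, ∑ k, projEntry i k (f.1 x) * projEntry i k (g.1 x) :=
    hg (Set.mem_univ (x : OnePoint ℝ))
  obtain ⟨hpx, hgx⟩ := hp x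
  obtain ⟨hqx, hfx⟩ := hq x
  simp only [eval_finsetSum, eval_mul] at hx
  refine hpos.ne' ?_
  rw [hfx, hgx]
  simp only [projEntry_mk]
  calc _ = (∑ i, (p i).eval x * (q i).eval x) * (∑ i, (p i).eval x * (q i).eval x) /
        ((∑ i, (p i).eval x ^ 2) * ∑ i, (q i).eval x ^ 2) := by
        rw [Finset.sum_mul_sum]
        simp only [Finset.sum_div]
        refine Finset.sum_congr rfl fun i _ => Finset.sum_congr rfl fun k _ => ?_
        rw [div_mul_div_comm]
        congr 1 <;> ring
    _ = 0 := by rw [hx]; simp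

lemma exists_sphere_relation {n m : ℕ} {g : OmegaRP m} (hg : g ∈ RRat n m) :
    ∃ c ∈ Metric.sphere (0 : Fin (m + 1) → Fin (n + 1) → ℝ) 1, ∀ (x : ℝ) (i j k : Fin (m + 1)),
      projEntry i k (g.1 x) * ∑ e, c j e * x ^ (e : ℕ) =
        projEntry j k (g.1 x) * ∑ e, c i e * x ^ (e : ℕ) := by
  obtain ⟨p, hpm, hpd, -, hp⟩ := hg
  let b : Fin (m + 1) → Fin (n + 1) → ℝ := fun j e => (p j).coeff e
  have hb (j) (x : ℝ) : ∑ e, b j e * x ^ (e : ℕ) = (p j).eval x := by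
    rw [eval_eq_sum_range, hpd j,
      Fin.sum_univ_eq_sum_range (fun e => (p j).coeff e * x ^ e) (n + 1)]
  have hb0 : b ≠ 0 := by
    intro h
    have h1 : (p 0).coeff n = 0 := congrFun (congrFun h 0) (Fin.last n)
    have h2 := (hpm 0).coeff_natDegree
    rw [hpd 0, h1] at h2
    exact zero_ne_one h2
  refine ⟨‖b‖⁻¹ • b, by simp [norm_smul, hb0], fun x i j k => ?_⟩
  simp only [Pi.smul_apply, smul_eq_mul, mul_assoc, ← Finset.mul_sum, hb]
  obtain ⟨hx, hgx⟩ := hp x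
  linear_combination ‖b‖⁻¹ * (eq_mk_iff _ _ hx).1 hgx i j k

lemma exists_polynomial_of_mem_closure_RRat {n m : ℕ} {f : OmegaRP m}
    (hf : f ∈ closure (RRat n m)) :
    ∃ p : Fin (m + 1) → ℝ[X], p ≠ 0 ∧ (∀ i, (p i).natDegree ≤ n) ∧
      ∀ (x : ℝ) (i j k : Fin (m + 1)),
        projEntry i k (f.1 x) * (p j).eval x = projEntry j k (f.1 x) * (p i).eval x := by
  obtain ⟨u, hu, huf⟩ := mem_closure_iff_ultrafilter.1 hf
  have hex (g : OmegaRP m) : ∃ c, g ∈ RRat n m →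
      c ∈ Metric.sphere (0 : Fin (m + 1) → Fin (n + 1) → ℝ) 1 ∧ ∀ (x : ℝ) (i j k : Fin (m + 1)),
      projEntry i k (g.1 x) * ∑ e, c j e * x ^ (e : ℕ) =
        projEntry j k (g.1 x) * ∑ e, c i e * x ^ (e : ℕ) := by
    by_cases hg : g ∈ RRat n m
    · obtain ⟨c, hc, h⟩ := exists_sphere_relation hg
      exact ⟨c, fun _ => ⟨hc, h⟩⟩
    · exact ⟨0, fun h => absurd h hg⟩
  choose C hC using hex
  obtain ⟨c, hc, hlim⟩ := (isCompact_sphere _ _).ultrafilter_le_nhds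
    (u.map C) (tendsto_principal.2 (mem_of_superset hu fun g hg => (hC g hg).1))
  have hlim : Tendsto C u (𝓝 c) := hlim
  let p : Fin (m + 1) → ℝ[X] := fun j => ∑ e, Polynomial.C (c j e) * X ^ (e : ℕ)
  have hp (j) (x : ℝ) : (p j).eval x = ∑ e, c j e * x ^ (e : ℕ) := by
    simp [p, eval_finsetSum]
  have hcoeff (j) (e : Fin (n + 1)) : (p j).coeff e = c j e := by
    simp [p, finsetSum_coeff, coeff_X_pow, Fin.val_inj]
  refine ⟨p, ?_, fun i => natDegree_sum_le_of_forall_le _ _ fun e _ =>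
    (natDegree_C_mul_X_pow_le _ _).trans (Nat.lt_succ_iff.1 e.2), fun x i j k => ?_⟩
  · intro h0
    have : c = 0 := by
      funext j e
      simp [← hcoeff, h0]
    simp [this] at hc
  · have hE (i k) : Tendsto (fun g : OmegaRP m => projEntry i k (g.1 x)) u
        (𝓝 (projEntry i k (f.1 x))) := by
      have : Continuous fun g : OmegaRP m => g.1 (x : OnePoint ℝ) := by fun_prop
      exact (((continuous_projEntry i k).comp this).tendsto f).mono_left huf
    have hS (j) : Tendsto (fun g : OmegaRP m => ∑ e, C g j e * x ^ (e : ℕ)) u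
        (𝓝 ((p j).eval x)) := by
      rw [hp]
      exact tendsto_finsetSum _ fun e _ =>
        (((continuous_apply_apply j e).tendsto c).comp hlim).mul_const _
    refine tendsto_nhds_unique_of_eventuallyEq ((hE i k).mul (hS j)) ((hE j k).mul (hS i)) ?_
    filter_upwards [hu] with g hg
    exact (hC g hg).2 x i j k

lemma exists_le_mem_RRat_of_mem_closure {n m : ℕ} {f : OmegaRP m} (hf : f ∈ closure (RRat n m)) :
    ∃ d ≤ n, f ∈ RRat d m := by
  obtain ⟨p, hp0, hpn, hp⟩ := exists_polynomial_of_mem_closure_RRat hf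
  obtain ⟨h, q, h0, hpq, hq⟩ := exists_eq_mul_unimodular hp0
  have hE (i k) : Continuous fun x : ℝ => projEntry i k (f.1 x) :=
    (continuous_projEntry i k).comp (f.1.continuous.comp continuous_coe)
  have hrel (x : ℝ) (i j k) :
      projEntry i k (f.1 x) * (q j).eval x = projEntry j k (f.1 x) * (q i).eval x := by
    have hdense : Dense {x : ℝ | h.eval x ≠ 0} :=
      ((finite_setOfPred_isRoot h0).countable).dense_compl ℝ
    refine congrFun (Continuous.ext_on hdense ((hE i k).mul (q j).continuous)
      ((hE j k).mul (q i).continuous) fun y hy => ?_) x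
    have := hp y i j k
    simp only [hpq, eval_mul] at this
    refine mul_left_cancel₀ hy ?_
    simp only [Pi.mul_apply]
    linear_combination this
  let d := Finset.univ.sup fun i => (q i).natDegree
  have hqd (i) : (q i).natDegree ≤ d := Finset.le_sup (f := fun i => (q i).natDegree)
    (Finset.mem_univ i)
  obtain ⟨i₀, -, hi₀⟩ := Finset.exists_mem_eq_sup Finset.univ Finset.univ_nonempty
    fun i => (q i).natDegree
  have hcoeff (i j) : (q i).coeff d = (q j).coeff d := by
    have hinf : Tendsto (fun x : ℝ => f.1 x) atTop (𝓝 (basept m)) := by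
      have h1 := f.1.continuous.tendsto ∞
      rw [f.2] at h1
      refine h1.comp (tendsto_coe_infty.mono_left ?_)
      rw [coclosedCompact_eq_cocompact]
      exact atTop_le_cocompact
    have hEinf (i k) : Tendsto (fun x : ℝ => projEntry i k (f.1 x)) atTop
        (𝓝 ((m + 1 : ℝ)⁻¹)) := by
      have := ((continuous_projEntry i k).tendsto _).comp hinf
      simpa [basept, projEntry_mk, Function.comp_def] using this
    have := tendsto_nhds_unique_of_eventuallyEq
      ((hEinf i i).mul (tendsto_eval_div_pow (hqd j)))
      ((hEinf j i).mul (tendsto_eval_div_pow (hqd i)))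
      (Eventually.of_forall fun x => by
        simp only [← mul_div_assoc, hrel x i j i])
    have hm : (m + 1 : ℝ)⁻¹ ≠ 0 := by positivity
    exact (mul_left_cancel₀ hm this).symm
  set a := (q i₀).coeff d
  have hqi₀ : q i₀ ≠ 0 := by
    intro hz
    have hd : d = 0 := by
      change Finset.univ.sup _ = 0
      rw [hi₀, hz, natDegree_zero]
    obtain ⟨j, hj⟩ := hq.exists_aeval_ne_zero (0 : ℝ)
    refine hj ?_
    have h1 := hqd j
    have h2 := hcoeff j i₀
    rw [hz, coeff_zero, hd] at h2
    rw [hd, Nat.le_zero] at h1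
    rw [eq_C_of_natDegree_eq_zero h1, h2]
    simp
  have ha : a ≠ 0 := by
    have : d = (q i₀).natDegree := hi₀
    simp only [a, this]
    simpa using hqi₀
  have hdi (i) : (q i).natDegree = d :=
    natDegree_eq_of_le_of_coeff_ne_zero (hqd i) (by rw [hcoeff i i₀]; exact ha)
  have hdn : d ≤ n := by
    refine le_trans ?_ (hpn i₀)
    rw [hpq, natDegree_mul h0 hqi₀, hdi]
    exact Nat.le_add_left _ _
  refine ⟨d, hdn, fun i => C a⁻¹ * q i, fun i => ?_, fun i => ?_, fun z => ?_, fun x => ?_⟩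
  · rw [Monic, leadingCoeff_mul, leadingCoeff_C, leadingCoeff, hdi, hcoeff i i₀]
    exact inv_mul_cancel₀ ha
  · rw [natDegree_C_mul (inv_ne_zero ha), hdi]
  · obtain ⟨i, hi⟩ := hq.exists_aeval_ne_zero z
    refine ⟨i, ?_⟩
    rw [map_mul, aeval_C]
    simpa [ha] using hi
  · obtain ⟨i, hi⟩ := hq.exists_aeval_ne_zero x
    have hx : (fun i => (C a⁻¹ * q i).eval x) ≠ 0 := by
      refine Function.ne_iff.2 ⟨i, ?_⟩
      simpa [ha] using hi
    refine ⟨hx, (eq_mk_iff _ _ hx).2 fun i j k => ?_⟩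
    simp only [eval_mul, eval_C]
    linear_combination a⁻¹ * hrel x i j k

/-- Rescaling of the zeroth homogeneous coordinate by the factor `1 + |s|`. -/
def stretch {m : ℕ} (l : RP m) (s : ℝ) : RP m :=
  Projectivization.map (LinearMap.pi fun i => (if i = 0 then 1 + |s| else 1) • LinearMap.proj i :
      (Fin (m + 1) → ℝ) →ₗ[ℝ] (Fin (m + 1) → ℝ))
    (fun v w h => funext fun i => by
      have hi := congrFun h i
      have : (if i = 0 then 1 + |s| else 1) ≠ 0 := by split_ifs <;> positivity
      exact mul_left_cancel₀ this hi) l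

lemma stretch_mk {m : ℕ} (v : Fin (m + 1) → ℝ) (hv : v ≠ 0) (s : ℝ) :
    ∃ h, stretch (Projectivization.mk ℝ v hv) s =
      Projectivization.mk ℝ (fun i => (if i = 0 then 1 + |s| else 1) * v i) h :=
  ⟨_, rfl⟩

lemma stretch_zero {m : ℕ} (l : RP m) : stretch l 0 = l := by
  induction l using Projectivization.ind with
  | h v hv =>
    obtain ⟨h, e⟩ := stretch_mk v hv 0
    rw [e]
    congr 1
    simp

lemma continuous_stretch (m : ℕ) : Continuous fun y : RP m × ℝ => stretch y.1 y.2 := by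
  refine (isQuotientMap_mk' m).continuous_lift_prod_left ?_
  refine (isQuotientMap_mk' m).continuous.comp (Continuous.subtype_mk ?_ _)
  refine continuous_pi fun i => ?_
  have hc : Continuous fun y : {v : Fin (m + 1) → ℝ // v ≠ 0} × ℝ => y.1.1 i :=
    (continuous_apply i).comp (continuous_subtype_val.comp continuous_fst)
  refine Continuous.mul ?_ hc
  split_ifs <;> fun_prop

/-- The function `x ↦ 1 / (x ^ 2 + a)` on the one-point compactification of the line. -/
def bump {a : ℝ} (ha : 0 < a) : C(OnePoint ℝ, ℝ) where
  toFun x := x.elim 0 fun x : ℝ => (x ^ 2 + a)⁻¹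
  continuous_toFun := by
    rw [OnePoint.continuous_iff]
    constructor
    · refine Tendsto.inv_tendsto_atTop (tendsto_atTop_add_const_right _ _ ?_)
      rw [coclosedCompact_eq_cocompact]
      refine (tendsto_pow_atTop two_ne_zero).comp
        (tendsto_norm_cocompact_atTop (E := ℝ)) |>.congr ?_
      simp
    · exact Continuous.inv₀ (by fun_prop) fun x => by positivity

/-- The loop `f` with zeroth coordinate rescaled by `1 + |t| / (x ^ 2 + a)`. -/
def stretchLoop {m : ℕ} (f : OmegaRP m) {a : ℝ} (ha : 0 < a) (t : ℝ) : OmegaRP m :=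
  ⟨⟨fun x => stretch (f.1 x) (t * bump ha x),
    (continuous_stretch m).comp
      (f.1.continuous.prodMk (continuous_const.mul (bump ha).continuous))⟩,
    by
      change stretch (f.1 ∞) (t * 0) = basept m
      rw [mul_zero, stretch_zero, f.2]⟩

lemma continuous_stretchLoop {m : ℕ} (f : OmegaRP m) {a : ℝ} (ha : 0 < a) :
    Continuous (stretchLoop f ha) := by
  refine Continuous.subtype_mk (ContinuousMap.continuous_of_continuous_uncurry _ ?_) _
  exact (continuous_stretch m).comp ((f.1.continuous.comp continuous_snd).prodMk
    (continuous_fst.mul ((bump ha).continuous.comp continuous_snd)))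

lemma stretchLoop_zero {m : ℕ} (f : OmegaRP m) {a : ℝ} (ha : 0 < a) : stretchLoop f ha 0 = f := by
  refine Subtype.ext (ContinuousMap.ext fun x => ?_)
  change stretch (f.1 x) (0 * _) = f.1 x
  rw [zero_mul, stretch_zero]

lemma finite_setOf_aeval_eq_zero {q : ℝ[X]} (hq : q ≠ 0) :
    {z : ℂ | aeval z q = 0}.Finite := by
  refine (finite_setOfPred_isRoot (p := q.map (algebraMap ℝ ℂ)) ?_).subset fun z hz => ?_
  · exact (Polynomial.map_ne_zero_iff (algebraMap ℝ ℂ).injective).2 hq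
  · simpa [IsRoot, eval_map_algebraMap] using hz

lemma finite_setOf_exists_sq_add {q : ℝ[X]} (hq : q ≠ 0) :
    {b : ℝ | ∃ z : ℂ, z ^ 2 + b = 0 ∧ aeval z q = 0}.Finite := by
  refine ((finite_setOf_aeval_eq_zero hq).image fun z => (-z ^ 2).re).subset ?_
  rintro b ⟨z, hz, hqz⟩
  refine ⟨z, hqz, ?_⟩
  have : -z ^ 2 = (b : ℂ) := by linear_combination -hz
  simp only [this, Complex.ofReal_re]

lemma RRat_subset_closure_RRat {d m : ℕ} (hm : 1 ≤ m) : RRat d m ⊆ closure (RRat (d + 2) m) := by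
  intro f hf
  obtain ⟨q, hqm, hqd, hqz, hq⟩ := hf
  obtain ⟨a, ha, ha'⟩ := ((Set.Ioi_infinite (0 : ℝ)).sdiff
    (finite_setOf_exists_sq_add (hqm 0).ne_zero)).nonempty
  have ha : 0 < a := ha
  let i₁ : Fin (m + 1) := ⟨1, by omega⟩
  have hi₁ : i₁ ≠ 0 := by simp [i₁, Fin.ext_iff]
  have hev : ∀ᶠ t in 𝓝[>] (0 : ℝ), stretchLoop f ha t ∈ RRat (d + 2) m := by
    have hfin := (finite_setOf_exists_sq_add (hqm i₁).ne_zero).preimage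
      (f := fun t : ℝ => a + t) (add_right_injective a).injOn
    have hbad : ∀ᶠ t in 𝓝[>] (0 : ℝ), ¬ ∃ z : ℂ, z ^ 2 + (a + t : ℝ) = 0 ∧
        aeval z (q i₁) = 0 := by
      have h1 := (hfin.sdiff (t := {(0 : ℝ)})).isClosed.isOpen_compl.mem_nhds
        (show (0 : ℝ) ∈ _ from fun h => h.2 rfl)
      filter_upwards [nhdsWithin_le_nhds h1, self_mem_nhdsWithin] with t ht ht0 hmem
      exact ht ⟨hmem, ne_of_gt ht0⟩
    filter_upwards [hbad, self_mem_nhdsWithin] with t ht ht0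
    have ht0 : 0 < t := ht0
    let r : Fin (m + 1) → ℝ[X] := fun i => X ^ 2 + C (if i = 0 then a + t else a)
    have hrm (i) : (r i).Monic := monic_X_pow_add_C _ two_ne_zero
    refine ⟨fun i => r i * q i, fun i => (hrm i).mul (hqm i), fun i => ?_, fun z => ?_,
      fun x => ?_⟩
    · rw [(hrm i).natDegree_mul (hqm i), hqd, natDegree_X_pow_add_C, add_comm]
    · by_contra! hz
      have hz0 : z ^ 2 + (a + t) = 0 ∨ aeval z (q 0) = 0 := by simpa [r] using hz 0
      have hzi (i) (hi : i ≠ 0) : z ^ 2 + a = 0 ∨ aeval z (q i) = 0 := by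
        simpa [r, hi] using hz i
      by_cases h1 : z ^ 2 + a = 0
      · rcases hz0 with h2 | h2
        · have : (t : ℂ) = 0 := by linear_combination h2 - h1
          exact ht0.ne' (by exact_mod_cast this)
        · exact ha' ⟨z, h1, h2⟩
      · have hqi (i) (hi : i ≠ 0) : aeval z (q i) = 0 := (hzi i hi).resolve_left h1
        rcases hz0 with h2 | h2
        · exact ht ⟨z, by push_cast; exact h2, hqi i₁ hi₁⟩
        · obtain ⟨i, hi⟩ := hqz z
          by_cases h : i = 0
          · exact hi (h ▸ h2)
          · exact hi (hqi i h)
    · obtain ⟨hx, hfx⟩ := hq x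
      have hr0 (i) : (r i).eval x ≠ 0 := by
        have : 0 < (r i).eval x := by
          simp only [r, eval_add, eval_pow, eval_X, eval_C]
          split_ifs <;> positivity
        exact this.ne'
      have hpx : (fun i => (r i * q i).eval x) ≠ 0 := by
        obtain ⟨i, hi⟩ := Function.ne_iff.1 hx
        refine Function.ne_iff.2 ⟨i, ?_⟩
        rw [eval_mul]
        exact mul_ne_zero (hr0 i) hi
      refine ⟨hpx, ?_⟩
      change stretch (f.1 x) (t * (x ^ 2 + a)⁻¹) = _
      rw [hfx]
      obtain ⟨h, e⟩ := stretch_mk _ hx (t * (x ^ 2 + a)⁻¹)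
      rw [e, Projectivization.mk_eq_mk_iff']
      refine ⟨(x ^ 2 + a)⁻¹, funext fun i => ?_⟩
      have hpos : 0 < x ^ 2 + a := by positivity
      have habs : |t * (x ^ 2 + a)⁻¹| = t * (x ^ 2 + a)⁻¹ := abs_of_pos (by positivity)
      simp only [Pi.smul_apply, smul_eq_mul, eval_mul, habs, r, eval_add, eval_pow, eval_X, eval_C]
      split_ifs <;> field_simp
      ring
  have hlim : Tendsto (stretchLoop f ha) (𝓝[>] 0) (𝓝 f) := by
    have := (continuous_stretchLoop f ha).tendsto 0
    rw [stretchLoop_zero] at this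
    exact this.mono_left nhdsWithin_le_nhds
  exact mem_closure_of_tendsto hlim hev

lemma RRat_subset_closure_RRat_add {d m : ℕ} (hm : 1 ≤ m) (j : ℕ) :
    RRat d m ⊆ closure (RRat (d + 2 * j) m) := by
  induction j with
  | zero => exact subset_closure
  | succ j ih => exact ih.trans (closure_minimal (RRat_subset_closure_RRat hm) isClosed_closure)

/-- For all `n ≥ 2` and `m ≥ 1`, the set difference `rat(n,m) ∖ rat(n−2,m)`
equals `RRat(n,m)`. -/
theorem ratSet_diff_ratSet (n m : ℕ) (hn : 2 ≤ n) (hm : 1 ≤ m) :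
    ratSet n m \ ratSet (n - 2) m = RRat n m := by
  refine Set.Subset.antisymm ?_ fun f hf => ⟨subset_closure hf, fun hf' => ?_⟩
  · rintro f ⟨hf, hf'⟩
    obtain ⟨d, hdn, hd⟩ := exists_le_mem_RRat_of_mem_closure hf
    obtain ⟨k, hk⟩ := even_add_of_mem_closure_RRat hf hd
    rcases hdn.eq_or_lt with rfl | hlt
    · exact hd
    · refine absurd ?_ hf'
      have : n - 2 = d + 2 * ((n - 2 - d) / 2) := by omega
      rw [ratSet, this]
      exact RRat_subset_closure_RRat_add hm _ hd
  · obtain ⟨d, hdn, hd⟩ := exists_le_mem_RRat_of_mem_closure hf'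
    have := eq_of_mem_RRat hf hd
    omega

end
end
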